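/- arXiv:2303.05450 — 2 statements merged into one kernel-verified Lean document; each statement's English description precedes it below -/
import Mathlib

section
/- Let b : [0,∞) → ℝ be continuously differentiable with b(0) > 0, linear growth (there exist M, m > 0 with b(t) ≤ M + m·t for all t ≥ 0), and satisfying -∞ < liminf_{t→0⁺} (b(t) - b(0))/t ≤ limsup_{t→0⁺} (b(t) - b(0))/t < ∞. Fix d ≥ 0. If f, f̃ : [0,∞) → ℝ are continuous, strictly positive on (0,∞), integrable functions such that for every c ≥ d the integrals ∫₀^∞ e^{-c²s/2 + c·b(s)} f(s) ds and ∫₀^∞ e^{-c²s/2 + c·b(s)} f̃(s) ds both exist and equal 1, then f = f̃. In other words, the Fredholm integral equation 1 = ∫₀^∞ e^{-c²s/2 + c·b(s)} f(s) ds (for all c ≥ d) has at most one solution in this class of functions. -/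
open MeasureTheory Real Filter Set


lemma laplace_ext (μ ν : Measure ℝ) 
    (hfin : ∀ θ < (1:ℝ), ∫⁻ t, ENNReal.ofReal (exp (θ * t)) ∂μ < ⊤)
    (heq : ∀ θ < (1:ℝ), ∫⁻ t, ENNReal.ofReal (exp (θ * t)) ∂μ = ∫⁻ t, ENNReal.ofReal (exp (θ * t)) ∂ν) :
    μ = ν := by
  have I1 : ∀ θ < (1:ℝ), Integrable (fun t => exp (θ * t)) μ := by
    intro θ h
    refine ⟨by fun_prop, ?_⟩
    rw [hasFiniteIntegral_iff_ofReal (ae_of_all _ fun t => (exp_pos _).le)]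
    exact hfin θ h
  have I2 : ∀ θ < (1:ℝ), Integrable (fun t => exp (θ * t)) ν := by
    intro θ h
    refine ⟨by fun_prop, ?_⟩
    rw [hasFiniteIntegral_iff_ofReal (ae_of_all _ fun t => (exp_pos _).le), ← heq θ h]
    exact hfin θ h
  have F1 : IsFiniteMeasure μ := by
    constructor
    simpa using hfin 0 one_pos
  have F2 : IsFiniteMeasure ν := by
    constructor
    have := hfin 0 one_pos
    rw [heq 0 one_pos] at this
    simpa using this
  have sub : ∀ ρ : Measure ℝ, (∀ θ < (1:ℝ), Integrable (fun t => exp (θ * t)) ρ) → 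
      {z : ℂ | z.re < 1} ⊆ {z | z.re ∈ interior (ProbabilityTheory.integrableExpSet id ρ)} := by
    intro ρ h z hz
    have : Iio (1:ℝ) ⊆ interior (ProbabilityTheory.integrableExpSet id ρ) := 
      interior_maximal (fun θ hθ => h θ hθ) isOpen_Iio
    exact this hz
  have A1 := ProbabilityTheory.analyticOnNhd_complexMGF (X := id) (μ := μ) |>.mono (sub μ I1)
  have A2 := ProbabilityTheory.analyticOnNhd_complexMGF (X := id) (μ := ν) |>.mono (sub ν I2)
  have E : EqOn (ProbabilityTheory.complexMGF id μ) (ProbabilityTheory.complexMGF id ν) {z : ℂ | z.re < 1} := by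
    refine A1.eqOn_of_preconnected_of_frequently_eq A2 (convex_halfSpace_re_lt 1).isPreconnected (z₀ := 0) (by simp) ?_
    have hf : ∃ᶠ x : ℝ in nhdsWithin 0 {0}ᶜ, x < 1 :=
      (eventually_nhdsWithin_of_eventually_nhds (eventually_lt_nhds one_pos)).frequently
    have tt : Tendsto (fun x : ℝ => (x:ℂ)) (nhdsWithin 0 {0}ᶜ) (nhdsWithin 0 {0}ᶜ) := by
      refine tendsto_nhdsWithin_iff.2 ⟨?_, ?_⟩
      · have := (Complex.continuous_ofReal.tendsto 0).mono_left (nhdsWithin_le_nhds (s := {0}ᶜ))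
        simpa using this
      · filter_upwards [self_mem_nhdsWithin] with x hx
        simpa using hx
    refine tt.frequently (hf.mono fun x hx => ?_)
    rw [ProbabilityTheory.complexMGF_ofReal, ProbabilityTheory.complexMGF_ofReal]
    congr 1
    simp only [ProbabilityTheory.mgf, id]
    rw [integral_eq_lintegral_of_nonneg_ae (ae_of_all _ fun t => (exp_pos _).le) (by fun_prop),
      integral_eq_lintegral_of_nonneg_ae (ae_of_all _ fun t => (exp_pos _).le) (by fun_prop), heq x hx]
  apply Measure.ext_of_charFun
  ext t
  rw [← ProbabilityTheory.complexMGF_id_mul_I, ← ProbabilityTheory.complexMGF_id_mul_I]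
  exact E (by simp)

noncomputable def gP (x : ℝ) : ℝ := ∫ u in Iic x, exp (-u^2/2)

lemma gauss_int : Integrable (fun u : ℝ => exp (-u^2/2)) := by
  convert integrable_exp_neg_mul_sq (b := 1/2) (by norm_num) using 3
  ring

lemma gP_deriv (x : ℝ) : HasDerivAt gP (exp (-x^2/2)) x := by
  have h : gP = fun x => (∫ u in Iic (0:ℝ), exp (-u^2/2)) + ∫ u in (0:ℝ)..x, exp (-u^2/2) := by
    ext y
    rw [← intervalIntegral.integral_Iic_sub_Iic gauss_int.integrableOn gauss_int.integrableOn]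
    simp [gP]
  rw [h]
  refine HasDerivAt.const_add _ ?_
  have hc : Continuous (fun u : ℝ => exp (-u^2/2)) := by fun_prop
  exact intervalIntegral.integral_hasDerivAt_right (hc.intervalIntegrable _ _) (hc.stronglyMeasurableAtFilter _ _) hc.continuousAt

noncomputable def gN : ℝ := ∫ u, exp (-u^2/2)

lemma gN_pos : 0 < gN := by
  rw [gN, integral_pos_iff_support_of_nonneg (fun t => (exp_pos _).le) gauss_int]
  have : Function.support (fun u : ℝ => exp (-u^2/2)) = univ := by
    ext x; simp [(exp_pos _).ne']
  rw [this]; simp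

lemma gP_top : Tendsto gP atTop (nhds gN) := by
  have := (aecover_Iic (μ := (volume : Measure ℝ)) (tendsto_id (α := ℝ) (x := atTop))).integral_tendsto_of_countably_generated gauss_int
  exact this

lemma gP_bot : Tendsto gP atBot (nhds 0) := by
  exact tendsto_integral_Iic_zero tendsto_id

noncomputable def Q (τ y : ℝ) : ℝ := y / (τ * √τ) * exp (-y^2/(2*τ))

lemma Q_nonpos {τ : ℝ} (h : τ ≤ 0) (y : ℝ) : Q τ y = 0 := by
  simp [Q, Real.sqrt_eq_zero_of_nonpos h]

lemma Q_nonneg (τ : ℝ) {y : ℝ} (hy : 0 ≤ y) : 0 ≤ Q τ y := by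
  rcases le_or_gt τ 0 with h | h
  · rw [Q_nonpos h]
  · unfold Q; positivity

lemma ftc_helper (F F' : ℝ → ℝ) (l : ℝ) (hd : ∀ x ∈ Ioi (0:ℝ), HasDerivAt F (F' x) x)
    (hp : ∀ x ∈ Ioi (0:ℝ), 0 ≤ F' x) (h0 : Tendsto F (nhdsWithin 0 (Ioi 0)) (nhds 0))
    (hl : Tendsto F atTop (nhds l)) : IntegrableOn F' (Ioi 0) ∧ ∫ x in Ioi 0, F' x = l := by
  have e : ∀ x ∈ Ioi (0:ℝ), (Ioi 0).indicator F x = F x := fun x hx => indicator_of_mem hx F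
  have hc : ContinuousWithinAt ((Ioi 0).indicator F) (Ici 0) 0 := by
    rw [← continuousWithinAt_Ioi_iff_Ici]
    unfold ContinuousWithinAt
    rw [indicator_of_notMem (by simp)]
    refine h0.congr' ?_
    filter_upwards [self_mem_nhdsWithin] with x hx using (e x hx).symm
  have hd' : ∀ x ∈ Ioi (0:ℝ), HasDerivAt ((Ioi 0).indicator F) (F' x) x := by
    intro x hx
    refine (hd x hx).congr_of_eventuallyEq ?_
    filter_upwards [Ioi_mem_nhds hx] with y hy using e y hy
  have hl' : Tendsto ((Ioi 0).indicator F) atTop (nhds l) := by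
    refine hl.congr' ?_
    filter_upwards [Ioi_mem_atTop 0] with x hx using (e x hx).symm
  refine ⟨integrableOn_Ioi_deriv_of_nonneg hc hd' hp hl', ?_⟩
  rw [integral_Ioi_of_hasDerivAt_of_nonneg hc hd' hp hl', indicator_of_notMem (by simp), sub_zero]

noncomputable def FF (a y τ : ℝ) : ℝ := gP (a * √τ - y / √τ) + exp (2*a*y) * gP (-(a * √τ) - y / √τ)

lemma FF_deriv (a y : ℝ) {τ : ℝ} (hτ : 0 < τ) :
    HasDerivAt (FF a y) (exp (a*y) * (Q τ y * exp (-a^2/2 * τ))) τ := by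
  have hs : 0 < √τ := Real.sqrt_pos.2 hτ
  have d0 : HasDerivAt (fun τ => √τ) (1 / (2 * √τ)) τ := Real.hasDerivAt_sqrt hτ.ne'
  have d1 : HasDerivAt (fun τ => y / √τ) (-(y * (1 / (2 * √τ))) / √τ^2) τ := by
    have := (hasDerivAt_const τ y).fun_div d0 hs.ne'
    simpa using this
  have d2 := (gP_deriv _).comp τ ((d0.const_mul a).sub d1)
  have d3 := ((gP_deriv _).comp τ ((d0.const_mul a).neg.sub d1)).const_mul (exp (2*a*y))
  refine HasDerivAt.congr_deriv (f := FF a y) (d2.add d3) (Eq.symm ?_)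
  unfold Q
  have hsq : √τ ^ 2 = τ := Real.sq_sqrt hτ.le
  have e1 : exp (-(a * √τ - y / √τ)^2/2) = exp (a*y) * (exp (-y^2/(2*τ)) * exp (-a^2/2 * τ)) := by
    rw [← exp_add, ← exp_add]
    congr 1
    have : (a * √τ - y / √τ)^2 = a^2 * τ - 2*a*y + y^2/τ := by
      rw [sub_sq, mul_pow, div_pow, hsq]; field_simp
    rw [this]; field_simp; ring
  have e2 : exp (2*a*y) * exp (-(-(a * √τ) - y / √τ)^2/2) = exp (a*y) * (exp (-y^2/(2*τ)) * exp (-a^2/2 * τ)) := by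
    rw [← exp_add, ← exp_add, ← exp_add]
    congr 1
    have : (-(a * √τ) - y / √τ)^2 = a^2 * τ + 2*a*y + y^2/τ := by
      rw [sub_sq, neg_sq, mul_pow, div_pow, hsq]; field_simp; ring
    rw [this]; field_simp; ring
  simp only [Pi.sub_apply, Pi.neg_apply]
  rw [← mul_assoc (exp (2*a*y)), e1, e2, hsq]
  field_simp
  ring

lemma sqrt_inv_top {y : ℝ} (hy : 0 < y) : Tendsto (fun τ : ℝ => y / √τ) (nhdsWithin 0 (Ioi 0)) atTop := by
  have h : Tendsto (fun τ : ℝ => √τ) (nhdsWithin 0 (Ioi 0)) (nhdsWithin 0 (Ioi 0)) := by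
    refine tendsto_nhdsWithin_iff.2 ⟨?_, ?_⟩
    · have := (Real.continuous_sqrt.tendsto 0).mono_left (nhdsWithin_le_nhds (s := Ioi 0))
      simpa using this
    · filter_upwards [self_mem_nhdsWithin] with x hx using Real.sqrt_pos.2 hx
  exact (tendsto_inv_nhdsGT_zero.comp h).const_mul_atTop hy

lemma sqrt_zero (a : ℝ) : Tendsto (fun τ : ℝ => a * √τ) (nhdsWithin 0 (Ioi 0)) (nhds 0) := by
  have h : Continuous (fun τ : ℝ => a * √τ) := by fun_prop
  have := (h.tendsto 0).mono_left (nhdsWithin_le_nhds (s := Ioi 0))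
  simpa using this

lemma FF_zero (a : ℝ) {y : ℝ} (hy : 0 < y) : Tendsto (FF a y) (nhdsWithin 0 (Ioi 0)) (nhds 0) := by
  have h1 : Tendsto (fun τ : ℝ => a * √τ - y / √τ) (nhdsWithin 0 (Ioi 0)) atBot := by
    simp_rw [sub_eq_add_neg]
    exact (sqrt_zero a).add_atBot (tendsto_neg_atTop_atBot.comp (sqrt_inv_top hy))
  have h2 : Tendsto (fun τ : ℝ => -(a * √τ) - y / √τ) (nhdsWithin 0 (Ioi 0)) atBot := by
    simp_rw [sub_eq_add_neg]
    exact (sqrt_zero a).neg.add_atBot (tendsto_neg_atTop_atBot.comp (sqrt_inv_top hy))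
  have := (gP_bot.comp h1).add ((gP_bot.comp h2).const_mul (exp (2*a*y)))
  unfold FF
  simpa using this

lemma sqrt_inv_zero (y : ℝ) : Tendsto (fun τ : ℝ => y / √τ) atTop (nhds 0) :=
  Real.tendsto_sqrt_atTop.const_div_atTop y

lemma FF_top {a : ℝ} (ha : 0 < a) (y : ℝ) : Tendsto (FF a y) atTop (nhds gN) := by
  have h0 : Tendsto (fun τ : ℝ => a * √τ) atTop atTop := Real.tendsto_sqrt_atTop.const_mul_atTop ha
  have h1 : Tendsto (fun τ : ℝ => a * √τ - y / √τ) atTop atTop := by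
    simp_rw [sub_eq_add_neg]
    exact h0.atTop_add (sqrt_inv_zero y).neg
  have h2 : Tendsto (fun τ : ℝ => -(a * √τ) - y / √τ) atTop atBot := by
    simp_rw [sub_eq_add_neg]
    exact (tendsto_neg_atTop_atBot.comp h0).atBot_add (sqrt_inv_zero y).neg
  have := (gP_top.comp h1).add ((gP_bot.comp h2).const_mul (exp (2*a*y)))
  unfold FF
  simpa using this

lemma FF_top0 (y : ℝ) : Tendsto (FF 0 y) atTop (nhds (gP 0 + gP 0)) := by
  have h1 : Tendsto (fun τ : ℝ => 0 * √τ - y / √τ) atTop (nhds 0) := by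
    simpa using (sqrt_inv_zero y).neg
  have h2 : Tendsto (fun τ : ℝ => -(0 * √τ) - y / √τ) atTop (nhds 0) := by
    simpa using (sqrt_inv_zero y).neg
  have c := (gP_deriv 0).continuousAt.tendsto
  have := (c.comp h1).add ((c.comp h2).const_mul (exp (2*0*y)))
  unfold FF
  simpa using this

lemma Q_laplace {a y : ℝ} (ha : 0 < a) (hy : 0 < y) :
    IntegrableOn (fun τ => Q τ y * exp (-a^2/2 * τ)) (Ioi 0) ∧
    ∫ τ in Ioi 0, Q τ y * exp (-a^2/2 * τ) = gN * exp (-(a*y)) := by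
  have h := ftc_helper (FF a y) _ gN (fun x hx => FF_deriv a y hx)
    (fun x hx => mul_nonneg (exp_pos _).le (mul_nonneg (Q_nonneg _ hy.le) (exp_pos _).le)) (FF_zero a hy) (FF_top ha y)
  have e := h.1.const_mul (exp (-(a*y)))
  have e2 := h.2
  rw [integral_const_mul] at e2
  constructor
  · refine e.congr (ae_of_all _ fun x => ?_)
    simp only
    rw [← mul_assoc, ← exp_add]; simp
  · rw [← e2, mul_comm, ← mul_assoc, ← exp_add]; simp

lemma Q_lint {a y : ℝ} (ha : 0 < a) (hy : 0 < y) :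
    ∫⁻ τ, ENNReal.ofReal (Q τ y * exp (-a^2/2 * τ)) = ENNReal.ofReal (gN * exp (-(a*y))) := by
  rw [← (Q_laplace ha hy).2, ofReal_integral_eq_lintegral_ofReal (Q_laplace ha hy).1
    (ae_of_all _ fun x => mul_nonneg (Q_nonneg _ hy.le) (exp_pos _).le)]
  rw [← lintegral_indicator measurableSet_Ioi]
  congr 1
  ext x
  by_cases hx : 0 < x
  · simp [hx]
  · simp [hx, Q_nonpos (not_lt.1 hx)]

lemma Q_one_int : IntegrableOn (fun u : ℝ => Q u 1) (Ioi 0) := by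
  have h := ftc_helper (FF 0 1) _ _ (fun x hx => FF_deriv 0 1 hx)
    (fun x hx => mul_nonneg (exp_pos _).le (mul_nonneg (Q_nonneg _ zero_le_one) (exp_pos _).le)) (FF_zero 0 one_pos) (FF_top0 1)
  simpa using h.1

lemma Q_one_pos : 0 < ∫ u in Ioi (0:ℝ), Q u 1 := by
  rw [setIntegral_pos_iff_support_of_nonneg_ae (ae_of_all _ fun x => Q_nonneg _ zero_le_one) Q_one_int]
  have : Ioi (0:ℝ) ⊆ Function.support (fun u : ℝ => Q u 1) := by
    intro x hx
    have hx : 0 < x := hx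
    have : 0 < Q x 1 := by unfold Q; positivity
    exact this.ne'
  rw [inter_eq_right.2 this]; simp


lemma Q_meas {α : Type*} [MeasurableSpace α] {u v : α → ℝ} (hu : Measurable u) (hv : Measurable v) :
    Measurable fun p => Q (u p) (v p) := by
  unfold Q
  have := Real.continuous_sqrt.measurable.comp hu
  exact (hv.div (hu.mul this)).mul (Real.measurable_exp.comp (((hv.pow_const 2).neg).div (hu.const_mul 2)))

noncomputable def HH (b f : ℝ → ℝ) (x t : ℝ) : ENNReal :=
  ∫⁻ s in Ioi (0:ℝ), ENNReal.ofReal (f s * Q (t - s) (x - b s))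

lemma HH_meas (b f : ℝ → ℝ) (x : ℝ) (hb : Measurable b) (hf : Measurable f) :
    Measurable (HH b f x) := by
  unfold HH
  refine Measurable.lintegral_prod_right' (f := fun p : ℝ × ℝ => ENNReal.ofReal (f p.2 * Q (p.1 - p.2) (x - b p.2))) ?_
  exact ((hf.comp measurable_snd).mul (Q_meas (by fun_prop) (by fun_prop))).ennreal_ofReal

lemma HH_laplace (b f : ℝ → ℝ) (x M : ℝ) (hb : Measurable b) (hf : Measurable f)
    (hf0 : ∀ s > 0, 0 ≤ f s) (hbM : ∀ s > 0, b s ≤ M) (hx : M < x) {a : ℝ} (ha : 0 < a) :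
    ∫⁻ t, ENNReal.ofReal (exp (-a^2/2 * t)) * HH b f x t =
      ENNReal.ofReal (gN * exp (-(a*x))) * ∫⁻ s in Ioi (0:ℝ), ENNReal.ofReal (exp (-a^2*s/2 + a * b s) * f s) := by
  have hm : Measurable fun p : ℝ × ℝ => ENNReal.ofReal (f p.2 * Q (p.1 - p.2) (x - b p.2)) :=
    ((hf.comp measurable_snd).mul (Q_meas (by fun_prop) (by fun_prop))).ennreal_ofReal
  have hm2 : Measurable fun p : ℝ × ℝ => ENNReal.ofReal (exp (-a^2/2 * p.1)) * ENNReal.ofReal (f p.2 * Q (p.1 - p.2) (x - b p.2)) := by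
    refine Measurable.mul ?_ hm
    fun_prop
  unfold HH
  calc _ = ∫⁻ t, ∫⁻ s in Ioi (0:ℝ), ENNReal.ofReal (exp (-a^2/2 * t)) * ENNReal.ofReal (f s * Q (t - s) (x - b s)) := by
        congr 1; ext t
        rw [lintegral_const_mul]
        exact hm.comp (measurable_const.prodMk measurable_id)
    _ = ∫⁻ s in Ioi (0:ℝ), ∫⁻ t, ENNReal.ofReal (exp (-a^2/2 * t)) * ENNReal.ofReal (f s * Q (t - s) (x - b s)) := by
        rw [lintegral_lintegral_swap]
        exact hm2.aemeasurable
    _ = ∫⁻ s in Ioi (0:ℝ), ENNReal.ofReal (gN * exp (-(a*x))) * ENNReal.ofReal (exp (-a^2*s/2 + a * b s) * f s) := by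
        refine setLIntegral_congr_fun measurableSet_Ioi fun s hs => ?_
        have hy : 0 < x - b s := by linarith [hbM s hs]
        have hfs := hf0 s hs
        calc _ = ∫⁻ t, ENNReal.ofReal (f s * exp (-a^2/2 * s)) * ENNReal.ofReal (Q (t - s) (x - b s) * exp (-a^2/2 * (t-s))) := by
              congr 1; ext t
              rw [← ENNReal.ofReal_mul (exp_pos _).le, ← ENNReal.ofReal_mul (by positivity)]
              congr 1
              have : exp (-a^2/2 * t) = exp (-a^2/2 * s) * exp (-a^2/2 * (t-s)) := by
                rw [← exp_add]; congr 1; ring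
              rw [this]; ring
          _ = ENNReal.ofReal (f s * exp (-a^2/2 * s)) * ∫⁻ t, ENNReal.ofReal (Q (t - s) (x - b s) * exp (-a^2/2 * (t-s))) := by
              rw [lintegral_const_mul]
              exact ((Q_meas (by fun_prop) (by fun_prop)).mul (by fun_prop)).ennreal_ofReal
          _ = _ := by
              rw [lintegral_sub_right_eq_self (fun t => ENNReal.ofReal (Q t (x - b s) * exp (-a^2/2 * t))) s,
                Q_lint ha hy, ← ENNReal.ofReal_mul (by positivity), ← ENNReal.ofReal_mul (mul_nonneg gN_pos.le (exp_pos _).le)]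
              congr 1
              have : exp (-a^2*s/2 + a * b s) = exp (-a^2/2 * s) * exp (a * b s) := by
                rw [← exp_add]; congr 1; ring
              have h2 : exp (-(a * (x - b s))) = exp (-(a*x)) * exp (a * b s) := by
                rw [← exp_add]; congr 1; ring
              rw [this, h2]; ring
    _ = _ := by
        rw [lintegral_const_mul]
        fun_prop

lemma kernel_eq (b f1 f2 : ℝ → ℝ) (x M : ℝ) (hb : Measurable b) (hf1 : Measurable f1) (hf2 : Measurable f2)
    (hf10 : ∀ s > 0, 0 ≤ f1 s) (hf20 : ∀ s > 0, 0 ≤ f2 s) (hbM : ∀ s > 0, b s ≤ M) (hx : M < x)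
    (hfin : ∀ a > (0:ℝ), ∫⁻ s in Ioi (0:ℝ), ENNReal.ofReal (exp (-a^2*s/2 + a * b s) * f1 s) < ⊤)
    (heq : ∀ a > (0:ℝ), ∫⁻ s in Ioi (0:ℝ), ENNReal.ofReal (exp (-a^2*s/2 + a * b s) * f1 s)
      = ∫⁻ s in Ioi (0:ℝ), ENNReal.ofReal (exp (-a^2*s/2 + a * b s) * f2 s)) :
    ∀ᵐ t, HH b f1 x t = HH b f2 x t := by
  have hm1 : Measurable fun t => ENNReal.ofReal (exp (-t)) * HH b f1 x t := 
    Measurable.mul (by fun_prop) (HH_meas b f1 x hb hf1)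
  have hm2 : Measurable fun t => ENNReal.ofReal (exp (-t)) * HH b f2 x t := 
    Measurable.mul (by fun_prop) (HH_meas b f2 x hb hf2)
  have key : ∀ f : ℝ → ℝ, Measurable f → (∀ s > 0, 0 ≤ f s) → ∀ θ < (1:ℝ), 
      ∫⁻ t, ENNReal.ofReal (exp (θ * t)) ∂(volume.withDensity fun t => ENNReal.ofReal (exp (-t)) * HH b f x t) =
      ENNReal.ofReal (gN * exp (-(√(2*(1-θ))*x))) * ∫⁻ s in Ioi (0:ℝ), ENNReal.ofReal (exp (-√(2*(1-θ))^2*s/2 + √(2*(1-θ)) * b s) * f s) := by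
    intro f hf hf0 θ hθ
    have hmf : Measurable fun t => ENNReal.ofReal (exp (-t)) * HH b f x t := 
      Measurable.mul (by fun_prop) (HH_meas b f x hb hf)
    have hme : Measurable fun t : ℝ => ENNReal.ofReal (exp (θ * t)) := by fun_prop
    have ha : 0 < √(2*(1-θ)) := Real.sqrt_pos.2 (by linarith)
    rw [← HH_laplace b f x M hb hf hf0 hbM hx ha, lintegral_withDensity_eq_lintegral_mul _ hmf hme]
    congr 1; ext t
    simp only [Pi.mul_apply]
    rw [mul_right_comm, ← ENNReal.ofReal_mul (exp_pos _).le, ← exp_add, Real.sq_sqrt (by linarith)]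
    congr 3; ring
  have E : (volume.withDensity fun t => ENNReal.ofReal (exp (-t)) * HH b f1 x t) = 
      (volume.withDensity fun t => ENNReal.ofReal (exp (-t)) * HH b f2 x t) := by
    refine laplace_ext _ _ ?_ ?_
    · intro θ hθ
      rw [key f1 hf1 hf10 θ hθ]
      exact ENNReal.mul_lt_top ENNReal.ofReal_lt_top (hfin _ (Real.sqrt_pos.2 (by linarith)))
    · intro θ hθ
      rw [key f1 hf1 hf10 θ hθ, key f2 hf2 hf20 θ hθ, heq _ (Real.sqrt_pos.2 (by linarith))]
  rw [withDensity_eq_iff_of_sigmaFinite hm1.aemeasurable hm2.aemeasurable] at E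
  filter_upwards [E] with t ht
  have hne : ENNReal.ofReal (exp (-t)) ≠ 0 := by simp [exp_pos]
  exact (ENNReal.mul_right_inj hne ENNReal.ofReal_ne_top).1 ht


/-- complex kernel -/
noncomputable def EC (z : ℂ) (τ : ℝ) : ℂ := (((τ * √τ)⁻¹ : ℝ) : ℂ) * Complex.exp (-z^2/(2*τ))

lemma exp_bound_tau {ρ τ t : ℝ} (hρ : 0 < ρ) (hτ : 0 < τ) (ht : τ ≤ t) :
    (τ * √τ)⁻¹ * exp (-ρ/(2*τ)) ≤ 48/ρ^3 * √t * τ := by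
  have hs : 0 < √τ := Real.sqrt_pos.2 hτ
  have hsq : √τ ^ 2 = τ := Real.sq_sqrt hτ.le
  have h1 : (ρ/(2*τ))^3/6 ≤ exp (ρ/(2*τ)) := by
    have := Real.pow_div_factorial_le_exp (ρ/(2*τ)) (by positivity) 3
    simpa [Nat.factorial] using this
  have h2 : exp (-ρ/(2*τ)) ≤ 48 * τ^3/ρ^3 := by
    rw [neg_div, exp_neg, inv_le_comm₀ (exp_pos _) (by positivity)]
    refine le_trans (le_of_eq ?_) h1
    field_simp
    norm_num
  calc (τ * √τ)⁻¹ * exp (-ρ/(2*τ)) ≤ (τ * √τ)⁻¹ * (48 * τ^3/ρ^3) := by gcongr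
    _ = 48/ρ^3 * √τ * τ := by
      field_simp
      nlinarith
    _ ≤ _ := by gcongr

lemma EC_bound {ρ R B t τ : ℝ} (hρ : 0 < ρ) (hτ : 0 < τ) (ht : τ ≤ t) (w : ℂ) (β : ℝ) (hβ : |β| ≤ B * τ)
    (hw0 : 0 ≤ w.re) (hwR : w.re ≤ R) (hw : ρ ≤ w.re^2 - w.im^2) :
    ‖EC (w + β) τ‖ ≤ 48/ρ^3 * √t * exp (R * B) * τ := by
  have hs : 0 < √τ := Real.sqrt_pos.2 hτ
  have hB : 0 ≤ B := by
    by_contra h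
    have := (abs_nonneg β).trans hβ
    nlinarith
  unfold EC
  rw [norm_mul, Complex.norm_exp, Complex.norm_real, Real.norm_of_nonneg (by positivity)]
  have e : (-(w + β)^2/(2*τ) : ℂ).re = -((w.re+β)^2 - w.im^2)/(2*τ) := by
    have : (-(w + β)^2/(2*τ) : ℂ) = (-(w+β)^2) / ((2*τ : ℝ) : ℂ) := by push_cast; rfl
    rw [this, Complex.div_ofReal_re]
    simp [sq]
  rw [e]
  have h1 : -((w.re+β)^2 - w.im^2)/(2*τ) ≤ -ρ/(2*τ) + R * B := by
    have : -ρ/(2*τ) + R * B = (-ρ + R*B*(2*τ))/(2*τ) := by field_simp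
    rw [this]
    gcongr
    have h2 : -(w.re * β) ≤ R * (B * τ) := by
      have := (neg_abs_le β)
      calc -(w.re * β) = w.re * (-β) := by ring
        _ ≤ w.re * (B*τ) := by gcongr; linarith
        _ ≤ _ := by gcongr
    nlinarith [sq_nonneg β]
  calc _ ≤ (τ * √τ)⁻¹ * exp (-ρ/(2*τ) + R * B) := by gcongr
    _ = ((τ * √τ)⁻¹ * exp (-ρ/(2*τ))) * exp (R*B) := by rw [exp_add]; ring
    _ ≤ (48/ρ^3 * √t * τ) * exp (R*B) := mul_le_mul_of_nonneg_right (exp_bound_tau hρ hτ ht) (exp_pos _).le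
    _ = _ := by ring

lemma EC_deriv (β : ℂ) {τ : ℝ} (hτ : 0 < τ) (z : ℂ) :
    HasDerivAt (fun z => (z - β) * EC (z - β) τ) ((1 - (z-β)^2/τ) * EC (z - β) τ) z := by
  have hτ' : (τ:ℂ) ≠ 0 := by exact_mod_cast hτ.ne'
  unfold EC
  have d := (hasDerivAt_id z).sub_const β
  have d2 := (((d.pow 2).neg.div_const (2*(τ:ℂ))).cexp.const_mul ((((τ * √τ)⁻¹ : ℝ)) : ℂ))
  have d3 := d.mul d2
  refine d3.congr_deriv ?_
  simp
  field_simp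
  ring

lemma EC_meas (b : ℝ → ℝ) (hb : Measurable b) (t : ℝ) (z : ℂ) : Measurable fun τ => EC (z - b (t - τ)) τ := by
  unfold EC
  have := Real.continuous_sqrt.measurable
  fun_prop

noncomputable def kC (b g : ℝ → ℝ) (t : ℝ) (z : ℂ) (τ : ℝ) : ℂ :=
  (g (t-τ) : ℂ) * ((z - b (t-τ)) * EC (z - b (t-τ)) τ)

lemma kC_deriv (b g : ℝ → ℝ) (hb : Measurable b) (hg : Measurable g) (t B G : ℝ)
    (hB : ∀ τ ∈ Ioc 0 t, |b t - b (t-τ)| ≤ B * τ) (hG : ∀ τ ∈ Ioc 0 t, |g (t-τ)| ≤ G) (z0 : ℂ)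
    (hz0 : |z0.im| < z0.re - b t) :
    IntegrableOn (kC b g t z0) (Ioc 0 t) ∧
    DifferentiableAt ℂ (fun z => ∫ τ in Ioc 0 t, kC b g t z τ) z0 := by
  set ρ : ℝ := ((z0.re - b t)^2 - z0.im^2)/2 with hρd
  have hρ : 0 < ρ := by
    have := sq_lt_sq' (by linarith [abs_nonneg z0.im]) hz0
    rw [sq_abs] at this
    rw [hρd]; linarith
  set R : ℝ := ‖z0 - b t‖ + 1 with hR
  set C : ℝ := 48/ρ^3 * √t * exp (R * B) with hC
  have hC0 : 0 ≤ C := by positivity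
  let S : Set ℂ := {z | ρ < (z.re - b t)^2 - z.im^2 ∧ 0 < z.re - b t ∧ ‖z - b t‖ < R}
  have hS : IsOpen S := by
    refine IsOpen.and ?_ (IsOpen.and ?_ ?_)
    · exact isOpen_lt (by fun_prop) (by fun_prop)
    · exact isOpen_lt (by fun_prop) (by fun_prop)
    · exact isOpen_lt (by fun_prop) (by fun_prop)
  have hzS : z0 ∈ S := ⟨by linarith, by linarith [abs_nonneg z0.im], by simp [hR]⟩
  have hEb : ∀ z ∈ S, ∀ τ ∈ Ioc 0 t, ‖EC (z - b (t-τ)) τ‖ ≤ C * τ := by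
    intro z hz τ hτ
    have : z - b (t-τ) = (z - b t) + ((b t - b (t-τ) : ℝ) : ℂ) := by push_cast; ring
    rw [this]
    refine EC_bound hρ hτ.1 hτ.2 _ _ (hB τ hτ) ?_ ?_ ?_
    · simpa using hz.2.1.le
    · exact (Complex.re_le_norm _).trans hz.2.2.le
    · simpa using hz.1.le
  have hnb : ∀ z ∈ S, ∀ τ ∈ Ioc 0 t, ‖z - b (t-τ)‖ ≤ R + |B| * t := by
    intro z hz τ hτ
    have : z - b (t-τ) = (z - b t) + ((b t - b (t-τ) : ℝ) : ℂ) := by push_cast; ring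
    rw [this]
    refine (norm_add_le _ _).trans (add_le_add hz.2.2.le ?_)
    rw [Complex.norm_real, Real.norm_eq_abs]
    refine (hB τ hτ).trans ?_
    calc B * τ ≤ |B| * τ := mul_le_mul_of_nonneg_right (le_abs_self B) hτ.1.le
      _ ≤ _ := by gcongr; exact hτ.2
  set R1 := R + |B| * t with hR1
  have hbc : ∀ z : ℂ, Measurable fun τ => z - (b (t-τ) : ℂ) := by intro z; fun_prop
  have hgc : Measurable fun τ => (g (t-τ) : ℂ) := by fun_prop
  have hkm : ∀ z, Measurable (kC b g t z) := fun z => hgc.mul ((hbc z).mul (EC_meas b hb t z))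
  let F' : ℂ → ℝ → ℂ := fun z τ => (g (t-τ) : ℂ) * ((1 - (z - b (t-τ))^2/τ) * EC (z - b (t-τ)) τ)
  have hFm : ∀ z, Measurable (F' z) := fun z => hgc.mul (Measurable.mul 
    (measurable_const.sub (((hbc z).pow_const 2).div (by fun_prop))) (EC_meas b hb t z))
  have hint : IntegrableOn (kC b g t z0) (Ioc 0 t) := by
    refine Measure.integrableOn_of_bounded (M := G * (R1 * (C * t))) (by simp) (hkm z0).aestronglyMeasurable ?_
    refine (ae_restrict_iff' measurableSet_Ioc).2 (ae_of_all _ fun τ hτ => ?_)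
    have h1 := hEb z0 hzS τ hτ
    have h2 := hnb z0 hzS τ hτ
    have h3 := hG τ hτ
    unfold kC
    rw [norm_mul, norm_mul, Complex.norm_real, Real.norm_eq_abs]
    have h4 : C * τ ≤ C * t := by gcongr; exact hτ.2
    have : 0 ≤ G := (abs_nonneg _).trans h3
    have : 0 ≤ R1 := (norm_nonneg _).trans h2
    gcongr
    exact h1.trans h4
  refine ⟨hint, ?_⟩
  refine (hasDerivAt_integral_of_dominated_loc_of_deriv_le (F := fun z τ => kC b g t z τ) (F' := F')
    (bound := fun _ => G * ((t + R1^2) * C)) (hS.mem_nhds hzS) ?_ hint ?_ ?_ ?_ ?_).2.differentiableAt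
  · exact Eventually.of_forall fun z => (hkm z).aestronglyMeasurable
  · exact (hFm z0).aestronglyMeasurable
  · refine (ae_restrict_iff' measurableSet_Ioc).2 (ae_of_all _ fun τ hτ z hz => ?_)
    have h1 := hEb z hz τ hτ
    have h2 := hnb z hz τ hτ
    have h3 := hG τ hτ
    have hτ0 : 0 < τ := hτ.1
    simp only [F']
    rw [norm_mul, norm_mul, Complex.norm_real, Real.norm_eq_abs]
    have : 0 ≤ G := (abs_nonneg _).trans h3
    have : 0 ≤ R1 := (norm_nonneg _).trans h2
    have h5 : ‖1 - (z - b (t-τ))^2/(τ:ℂ)‖ ≤ 1 + R1^2/τ := by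
      refine (norm_sub_le _ _).trans ?_
      rw [norm_one, norm_div, norm_pow, Complex.norm_real, Real.norm_of_nonneg hτ0.le]
      gcongr
    have h6 : ‖1 - (z - b (t-τ))^2/(τ:ℂ)‖ * ‖EC (z - b (t-τ)) τ‖ ≤ (t + R1^2) * C := by
      calc _ ≤ (1 + R1^2/τ) * (C * τ) := by gcongr
        _ = (τ + R1^2) * C := by field_simp
        _ ≤ _ := by gcongr; exact hτ.2
    gcongr
  · exact integrable_const _
  · refine (ae_restrict_iff' measurableSet_Ioc).2 (ae_of_all _ fun τ hτ z hz => ?_)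
    exact (EC_deriv _ hτ.1 z).const_mul _

lemma kC_real (b g : ℝ → ℝ) (t x τ : ℝ) : kC b g t x τ = ((g (t-τ) * Q τ (x - b (t-τ)) : ℝ) : ℂ) := by
  unfold kC EC Q
  push_cast
  ring

lemma real_int (b g : ℝ → ℝ) (hb : Measurable b) (hg : Measurable g) (t B G : ℝ)
    (hB : ∀ τ ∈ Ioc 0 t, |b t - b (t-τ)| ≤ B * τ) (hG : ∀ τ ∈ Ioc 0 t, |g (t-τ)| ≤ G) (x : ℝ) (hx : b t < x) :
    IntegrableOn (fun τ => g (t-τ) * Q τ (x - b (t-τ))) (Ioc 0 t) := by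
  have := (kC_deriv b g hb hg t B G hB hG x (by simpa using hx)).1
  simp only [funext (kC_real b g t x)] at this
  have h2 := this.re
  unfold IntegrableOn
  simpa using h2

lemma extend (b g : ℝ → ℝ) (hb : Measurable b) (hg : Measurable g) (t B G M : ℝ)
    (hB : ∀ τ ∈ Ioc 0 t, |b t - b (t-τ)| ≤ B * τ) (hG : ∀ τ ∈ Ioc 0 t, |g (t-τ)| ≤ G) (hM : b t ≤ M)
    (hz : ∀ n : ℕ, ∫ τ in Ioc 0 t, g (t-τ) * Q τ (M + 1 + 1/((n:ℝ)+1) - b (t-τ)) = 0) (x : ℝ) (hx : b t < x) :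
    ∫ τ in Ioc 0 t, g (t-τ) * Q τ (x - b (t-τ)) = 0 := by
  let U : Set ℂ := {z | |z.im| < z.re - b t}
  have hU : IsOpen U := isOpen_lt (by fun_prop) (by fun_prop)
  have hUc : Convex ℝ U := by
    intro z hz w hw p q hp hq hpq
    simp only [U, mem_ofPred_eq, abs_lt] at hz hw ⊢
    simp only [Complex.add_re, Complex.add_im, Complex.real_smul, Complex.re_ofReal_mul, Complex.im_ofReal_mul]
    have : b t = p * b t + q * b t := by rw [← add_mul, hpq, one_mul]
    rcases hp.eq_or_lt with h | h
    · have hq1 : q = 1 := by linarith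
      subst hq1; subst h; constructor <;> linarith
    · constructor <;> nlinarith
  have hD : DifferentiableOn ℂ (fun z => ∫ τ in Ioc 0 t, kC b g t z τ) U := fun z hz =>
    (kC_deriv b g hb hg t B G hB hG z hz).2.differentiableWithinAt
  have hreal : ∀ x : ℝ, (∫ τ in Ioc 0 t, kC b g t x τ) = ((∫ τ in Ioc 0 t, g (t-τ) * Q τ (x - b (t-τ)) : ℝ) : ℂ) := by
    intro x
    rw [← integral_complex_ofReal]
    congr 1; ext τ; exact kC_real b g t x τ
  have hZ := (hD.analyticOnNhd hU).eqOn_zero_of_preconnected_of_frequently_eq_zero hUc.isPreconnected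
    (z₀ := ((M+1 : ℝ) : ℂ)) (by simp [U]; linarith) (by
      have tt : Tendsto (fun n : ℕ => ((M + 1 + 1/((n:ℝ)+1) : ℝ) : ℂ)) atTop (nhdsWithin ((M+1 : ℝ) : ℂ) {((M+1 : ℝ) : ℂ)}ᶜ) := by
        refine tendsto_nhdsWithin_iff.2 ⟨?_, ?_⟩
        · refine (Complex.continuous_ofReal.tendsto _).comp ?_
          simpa using (tendsto_one_div_add_atTop_nhds_zero_nat (𝕜 := ℝ)).const_add (M+1)
        · refine Eventually.of_forall fun n => ?_
          have : (0:ℝ) < 1/((n:ℝ)+1) := by positivity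
          simp only [mem_compl_iff, mem_singleton_iff, Complex.ofReal_inj]
          linarith
      refine tt.frequently (Frequently.of_forall fun n => ?_)
      rw [hreal, hz n]; simp)
  have := hZ (show (x:ℂ) ∈ U by simpa [U] using hx)
  simp only [Pi.zero_apply] at this
  rw [hreal] at this
  exact_mod_cast this


lemma inv_sqrt_int (t : ℝ) : IntegrableOn (fun τ : ℝ => 1/√τ) (Ioc 0 t) := by
  have h := (intervalIntegral.intervalIntegrable_rpow' (a := 0) (b := t) (r := -(1/2)) (by norm_num)).1
  refine h.congr_fun (fun x hx => ?_) measurableSet_Ioc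
  simp only
  rw [rpow_neg hx.1.le, Real.sqrt_eq_rpow, one_div, one_div]

lemma limit_bound (b g : ℝ → ℝ) (hb : Measurable b) (hg : Measurable g) (t B G : ℝ) (ht : 0 < t) (hB0 : 0 ≤ B)
    (hB : ∀ τ ∈ Ioc 0 t, |b t - b (t-τ)| ≤ B * τ) (hG : ∀ τ ∈ Ioc 0 t, |g (t-τ)| ≤ G)
    (hgc : ContinuousAt g t)
    (hz : ∀ x, b t < x → ∫ τ in Ioc 0 t, g (t-τ) * Q τ (x - b (t-τ)) = 0) :
    |g t| * ∫ u in Ioi (0:ℝ), Q u 1 ≤ B * ∫ τ in Ioc 0 t, |g (t-τ)| * (1/√τ) := by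
  have hsm := Real.continuous_sqrt.measurable
  have hG0 : 0 ≤ G := (abs_nonneg _).trans (hG t ⟨ht, le_rfl⟩)
  let β : ℝ → ℝ := fun τ => b t - b (t-τ)
  have hβm : Measurable β := by fun_prop
  let l : ℝ → ℝ → ℝ := fun ε τ => g (t-τ) * (ε / (τ * √τ) * exp (-(ε + β τ)^2/(2*τ)))
  let J : ℝ → ℝ → ℝ := fun ε τ => g (t-τ) * (β τ / (τ * √τ) * exp (-(ε + β τ)^2/(2*τ)))
  have hdom : IntegrableOn (fun τ => |g (t-τ)| * (1/√τ)) (Ioc 0 t) := by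
    refine ((inv_sqrt_int t).const_mul G).mono' (by
      exact (Measurable.mul (by fun_prop) (by fun_prop)).aestronglyMeasurable) ?_
    refine (ae_restrict_iff' measurableSet_Ioc).2 (ae_of_all _ fun τ hτ => ?_)
    rw [Real.norm_of_nonneg (by positivity)]
    have := hG τ hτ
    gcongr
  have hJb : ∀ ε, ∀ τ ∈ Ioc 0 t, ‖J ε τ‖ ≤ B * (|g (t-τ)| * (1/√τ)) := by
    intro ε τ hτ
    have hτ0 : 0 < τ := hτ.1
    have hs : 0 < √τ := Real.sqrt_pos.2 hτ0
    simp only [J, norm_mul, Real.norm_eq_abs, abs_div, abs_of_pos (exp_pos _), abs_of_pos (show 0 < τ * √τ by positivity)]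
    have h1 : exp (-(ε + β τ)^2/(2*τ)) ≤ 1 := by
      rw [exp_le_one_iff]
      apply div_nonpos_of_nonpos_of_nonneg
      · linarith [sq_nonneg (ε + β τ)]
      · positivity
    have h2 : |β τ| / (τ * √τ) ≤ B * (1/√τ) := by
      calc |β τ| / (τ * √τ) ≤ B * τ / (τ * √τ) := by gcongr; exact hB τ hτ
        _ = _ := by field_simp
    calc _ ≤ |g (t-τ)| * (B * (1/√τ) * 1) := by gcongr
      _ = _ := by ring
  have hJm : ∀ ε, Measurable (J ε) := by
    intro ε
    have : Measurable (fun τ => g (t-τ)) := by fun_prop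
    exact this.mul (by fun_prop)
  have hJi : ∀ ε, IntegrableOn (J ε) (Ioc 0 t) := fun ε =>
    (hdom.const_mul B).mono' (hJm ε).aestronglyMeasurable
      ((ae_restrict_iff' measurableSet_Ioc).2 (ae_of_all _ fun τ hτ => hJb ε τ hτ))
  have hL : ∀ ε > 0, |∫ τ in Ioc 0 t, l ε τ| ≤ B * ∫ τ in Ioc 0 t, |g (t-τ)| * (1/√τ) := by
    intro ε hε
    have e : ∀ τ, l ε τ = g (t-τ) * Q τ (b t + ε - b (t-τ)) - J ε τ := by
      intro τ
      simp only [l, J, Q]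
      have : b t + ε - b (t-τ) = ε + β τ := by simp only [β]; ring
      rw [this]; ring
    simp_rw [e]
    rw [integral_sub (real_int b g hb hg t B G hB hG _ (by linarith)) (hJi ε), hz _ (by linarith), zero_sub, abs_neg,
      ← integral_const_mul]
    rw [← Real.norm_eq_abs]
    refine norm_integral_le_of_norm_le (hdom.const_mul B) ?_
    exact (ae_restrict_iff' measurableSet_Ioc).2 (ae_of_all _ fun τ hτ => hJb ε τ hτ)
  let h : ℝ → ℝ → ℝ := fun ε u => if ε^2*u ≤ t then 
    g (t - ε^2*u) * (1/(u*√u) * exp (-(1 + β (ε^2*u)/ε)^2/(2*u))) else 0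
  have hsub : ∀ ε > 0, ∫ τ in Ioc 0 t, l ε τ = ∫ u in Ioi (0:ℝ), h ε u := by
    intro ε hε
    have h1 : ∫ τ in Ioc 0 t, l ε τ = ∫ τ in Ioi (0:ℝ), (Iic t).indicator (l ε) τ := by
      rw [setIntegral_indicator measurableSet_Iic, Ioi_inter_Iic]
    have h2 := integral_comp_mul_left_Ioi' (fun τ => (Iic t).indicator (l ε) τ) 0 (b := ε^2) (by positivity)
    rw [mul_zero] at h2
    rw [h1, ← h2, ← integral_smul]
    refine setIntegral_congr_fun measurableSet_Ioi fun u hu => ?_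
    have hu : 0 < u := hu
    have hs : 0 < √u := Real.sqrt_pos.2 hu
    simp only [h, indicator, mem_Iic]
    split_ifs with hc
    · simp only [l, smul_eq_mul]
      rw [Real.sqrt_mul (by positivity), Real.sqrt_sq hε.le]
      have e1 : -(ε + β (ε^2*u))^2/(2*(ε^2*u)) = -(1 + β (ε^2*u)/ε)^2/(2*u) := by
        field_simp
      rw [e1]
      field_simp
    · simp
  have hlim : Tendsto (fun ε => ∫ u in Ioi (0:ℝ), h ε u) (nhdsWithin 0 (Ioi 0)) (nhds (∫ u in Ioi (0:ℝ), g t * Q u 1)) := by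
    have hev : ∀ᶠ ε in nhdsWithin (0:ℝ) (Ioi 0), 0 < ε ∧ ε < 1 := by
      filter_upwards [Ioo_mem_nhdsGT (one_pos (α := ℝ))] with ε hε using hε
    refine tendsto_integral_filter_of_dominated_convergence (fun u => G * exp B * Q u 1) ?_ ?_ (Q_one_int.const_mul _) ?_
    · refine Eventually.of_forall fun ε => ?_
      refine Measurable.aestronglyMeasurable ?_
      refine Measurable.ite (measurableSet_le (by fun_prop) (by fun_prop)) ?_ measurable_const
      have : Measurable (fun u => g (t-ε^2*u)) := by fun_prop
      exact this.mul (by fun_prop)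
    · filter_upwards [hev] with ε hε
      refine (ae_restrict_iff' measurableSet_Ioi).2 (ae_of_all _ fun u hu => ?_)
      have hu : 0 < u := hu
      have hs : 0 < √u := Real.sqrt_pos.2 hu
      have hε0 := hε.1
      simp only [h]
      split_ifs with hc
      · have hmem : ε^2*u ∈ Ioc 0 t := ⟨by positivity, hc⟩
        simp only [norm_mul, Real.norm_eq_abs, abs_of_pos (exp_pos _), abs_of_pos (show 0 < 1/(u*√u) by positivity)]
        have h1 := hG _ hmem
        have h2 := (abs_le.1 (hB _ hmem)).1
        have h3 : -(1 + β (ε^2*u)/ε)^2/(2*u) ≤ B + -1^2/(2*u) := by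
          have : B + -1^2/(2*u) = (B * (2*u) - 1)/(2*u) := by field_simp; ring
          rw [this]
          gcongr
          have h4 : -(B*u) ≤ β (ε^2*u)/ε := by
            rw [le_div_iff₀ hε0]
            have : B * (ε^2*u) ≤ B * u * ε := by
              have : ε^2 ≤ ε := by nlinarith [hε.2]
              calc B * (ε^2*u) ≤ B * (ε * u) := by gcongr
                _ = _ := by ring
            simp only [β]
            linarith
          nlinarith [sq_nonneg (β (ε^2*u)/ε)]
        calc _ ≤ G * (1/(u*√u) * exp (B + -1^2/(2*u))) := by gcongr
          _ = _ := by rw [exp_add]; unfold Q; ring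
      · rw [norm_zero]
        have := Q_nonneg u zero_le_one
        positivity
    · refine (ae_restrict_iff' measurableSet_Ioi).2 (ae_of_all _ fun u hu => ?_)
      have hu : 0 < u := hu
      have t0 : Tendsto (fun ε : ℝ => ε^2*u) (nhdsWithin 0 (Ioi 0)) (nhds 0) := by
        have hc : Continuous (fun ε : ℝ => ε^2*u) := by fun_prop
        have := (hc.tendsto 0).mono_left (nhdsWithin_le_nhds (s := Ioi 0))
        simpa using this
      have t1 : Tendsto (fun ε : ℝ => g (t - ε^2*u)) (nhdsWithin 0 (Ioi 0)) (nhds (g t)) := by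
        refine hgc.tendsto.comp ?_
        simpa using t0.const_sub t
      have hle : ∀ᶠ ε in nhdsWithin (0:ℝ) (Ioi 0), ε^2*u ≤ t := t0.eventually_le_const ht
      have t2 : Tendsto (fun ε : ℝ => β (ε^2*u)/ε) (nhdsWithin 0 (Ioi 0)) (nhds 0) := by
        refine squeeze_zero_norm' (a := fun ε => B * u * ε) ?_ ?_
        · filter_upwards [hle, self_mem_nhdsWithin] with ε h1 h2
          have h2 : 0 < ε := h2
          rw [norm_div, Real.norm_of_nonneg h2.le, div_le_iff₀ h2]
          refine (hB _ ⟨by positivity, h1⟩).trans (le_of_eq (by ring))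
        · have hc : Continuous (fun ε : ℝ => B*u*ε) := by fun_prop
          have := (hc.tendsto 0).mono_left (nhdsWithin_le_nhds (s := Ioi 0))
          simpa using this
      have t3 : Tendsto (fun ε : ℝ => exp (-(1 + β (ε^2*u)/ε)^2/(2*u))) (nhdsWithin 0 (Ioi 0)) (nhds (exp (-1^2/(2*u)))) := by
        refine (Real.continuous_exp.tendsto _).comp ?_
        have := (((t2.const_add 1).pow 2).neg).div_const (2*u)
        simpa using this
      have t4 := t1.mul (t3.const_mul (1/(u*√u)))
      have : g t * (1/(u*√u) * exp (-1^2/(2*u))) = g t * Q u 1 := by unfold Q; ring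
      rw [this] at t4
      refine t4.congr' ?_
      filter_upwards [hle] with ε h1
      simp only [h, if_pos h1]
  rw [integral_const_mul] at hlim
  have h5 := le_of_tendsto hlim.abs (by
    filter_upwards [self_mem_nhdsWithin] with ε hε
    rw [← hsub ε hε]
    exact hL ε hε)
  rwa [abs_mul, abs_of_pos Q_one_pos] at h5

lemma gronwall (g : ℝ → ℝ) (hg : Continuous g) (T B c : ℝ) (hT : 0 < T) (hB : 0 ≤ B) (hc : 0 < c)
    (h : ∀ᵐ t, t ∈ Ioo 0 T → |g t| * c ≤ B * ∫ τ in Ioc 0 t, |g (t-τ)| * (1/√τ)) :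
    ∀ t ∈ Icc 0 T, g t = 0 := by
  have hΓ : 0 < Real.Gamma (1/2) := Real.Gamma_pos_of_pos (by norm_num)
  set δ : ℝ := c / (2 * (B+1) * Real.Gamma (1/2)) with hδ
  have hδ0 : 0 < δ := by positivity
  set κ : ℝ := 1/δ^2 with hκ
  have hκ0 : 0 < κ := by positivity
  have hA : ∫ τ in Ioi (0:ℝ), τ^((1/2:ℝ)-1) * exp (-(κ*τ)) = δ * Real.Gamma (1/2) := by
    rw [Real.integral_rpow_mul_exp_neg_mul_Ioi (by norm_num) hκ0]
    congr 1
    rw [hκ, one_div_one_div, ← Real.sqrt_eq_rpow, Real.sqrt_sq hδ0.le]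
  have hAi : IntegrableOn (fun τ : ℝ => τ^((1/2:ℝ)-1) * exp (-(κ*τ))) (Ioi 0) := by
    by_contra hn
    rw [integral_undef hn] at hA
    have : 0 < δ * Real.Gamma (1/2) := by positivity
    linarith
  obtain ⟨t0, ht0, hmax⟩ := isCompact_Icc.exists_isMaxOn (nonempty_Icc.2 hT.le)
    (f := fun t => |g t| * exp (-(κ*t))) (by fun_prop)
  set S := |g t0| * exp (-(κ*t0)) with hS
  have hS0 : 0 ≤ S := by positivity
  have hgS : ∀ t ∈ Icc 0 T, |g t| ≤ S * exp (κ*t) := by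
    intro t ht
    have : |g t| * exp (-(κ*t)) ≤ S := hmax ht
    rw [exp_neg, ← div_eq_mul_inv, div_le_iff₀ (exp_pos _)] at this
    exact this
  have hae : ∀ᵐ t, t ∈ Ioo 0 T → |g t| * exp (-(κ*t)) ≤ S/2 := by
    filter_upwards [h] with t ht htm
    have h1 := ht htm
    have h2 : ∫ τ in Ioc 0 t, |g (t-τ)| * (1/√τ) ≤ S * exp (κ*t) * (δ * Real.Gamma (1/2)) := by
      calc _ ≤ ∫ τ in Ioc 0 t, S * exp (κ*t) * (τ^((1/2:ℝ)-1) * exp (-(κ*τ))) := by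
            refine integral_mono_of_nonneg (ae_of_all _ fun τ => by positivity)
              ((hAi.mono_set Ioc_subset_Ioi_self).const_mul _) ?_
            refine (ae_restrict_iff' measurableSet_Ioc).2 (ae_of_all _ fun τ hτ => ?_)
            have h3 := hgS (t-τ) ⟨by linarith [hτ.2], by linarith [hτ.1, htm.2]⟩
            have h4 : τ^((1/2:ℝ)-1) = 1/√τ := by
              rw [show (1/2:ℝ)-1 = -(1/2) by norm_num, rpow_neg hτ.1.le, Real.sqrt_eq_rpow, one_div]
              norm_num
            have h5 : exp (κ*(t-τ)) = exp (κ*t) * exp (-(κ*τ)) := by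
              rw [← exp_add]; congr 1; ring
            simp only
            rw [h4]
            rw [h5] at h3
            calc _ ≤ (S * (exp (κ*t) * exp (-(κ*τ)))) * (1/√τ) := by gcongr
              _ = _ := by ring
        _ = S * exp (κ*t) * ∫ τ in Ioc 0 t, (τ^((1/2:ℝ)-1) * exp (-(κ*τ))) := integral_const_mul _ _
        _ ≤ S * exp (κ*t) * ∫ τ in Ioi 0, (τ^((1/2:ℝ)-1) * exp (-(κ*τ))) := by
            refine mul_le_mul_of_nonneg_left ?_ (by positivity)
            refine setIntegral_mono_set hAi ?_ (Eventually.of_forall Ioc_subset_Ioi_self)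
            refine (ae_restrict_iff' measurableSet_Ioi).2 (ae_of_all _ fun τ hτ => ?_)
            have hτ : 0 < τ := hτ
            simp only [Pi.zero_apply]
            positivity
        _ = _ := by rw [hA]
    have h3 : |g t| * c ≤ S * exp (κ*t) * (c/2) := by
      calc _ ≤ B * (S * exp (κ*t) * (δ * Real.Gamma (1/2))) := h1.trans (by gcongr)
        _ ≤ (B+1) * (S * exp (κ*t) * (δ * Real.Gamma (1/2))) := by gcongr; linarith
        _ = _ := by rw [hδ]; field_simp
    have h4 : |g t| ≤ S/2 * exp (κ*t) := by
      refine le_of_mul_le_mul_right ?_ hc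
      linarith
    rw [exp_neg, ← div_eq_mul_inv, div_le_iff₀ (exp_pos _)]
    exact h4
  have hall : ∀ t ∈ Icc 0 T, |g t| * exp (-(κ*t)) ≤ S/2 := by
    have hcl : IsClosed {t | |g t| * exp (-(κ*t)) ≤ S/2} := isClosed_le (by fun_prop) (by fun_prop)
    have hIoo : Ioo 0 T ⊆ {t | |g t| * exp (-(κ*t)) ≤ S/2} := by
      intro t ht
      by_contra hn
      have ho : IsOpen (Ioo 0 T ∩ {t | |g t| * exp (-(κ*t)) ≤ S/2}ᶜ) := isOpen_Ioo.inter hcl.isOpen_compl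
      have hpos := ho.measure_pos volume ⟨t, ht, hn⟩
      refine hpos.ne' ?_
      refine measure_mono_null ?_ hae
      rintro u ⟨hu1, hu2⟩ hu3
      exact hu2 (hu3 hu1)
    rw [← closure_Ioo hT.ne]
    exact closure_minimal hIoo hcl
  have hSz : S = 0 := by
    have := hall t0 ht0
    linarith
  intro t ht
  have := hgS t ht
  rw [hSz, zero_mul] at this
  exact abs_nonpos_iff.1 this


lemma HH_real (b f : ℝ → ℝ) (hb : Measurable b) (hf : Measurable f) (t B G M x : ℝ)
    (hf0 : ∀ s > 0, 0 ≤ f s) (hbM : ∀ s > 0, b s ≤ M) (hx : M < x) (ht : 0 < t)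
    (hB : ∀ τ ∈ Ioc 0 t, |b t - b (t-τ)| ≤ B * τ) (hG : ∀ τ ∈ Ioc 0 t, |f (t-τ)| ≤ G) :
    HH b f x t = ENNReal.ofReal (∫ τ in Ioc 0 t, f (t-τ) * Q τ (x - b (t-τ))) := by
  have hi := real_int b f hb hf t B G hB hG x ((hbM t ht).trans_lt hx)
  rw [integral_Ioc_eq_integral_Ioo, ofReal_integral_eq_lintegral_ofReal (hi.mono_set Ioo_subset_Ioc_self)
    ((ae_restrict_iff' measurableSet_Ioo).2 (ae_of_all _ fun τ hτ => ?_))]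
  · unfold HH
    rw [← lintegral_indicator measurableSet_Ioi, ← lintegral_indicator measurableSet_Ioo,
      ← lintegral_sub_left_eq_self _ t]
    congr 1; ext τ
    by_cases h1 : 0 < τ
    · by_cases h2 : τ < t
      · rw [indicator_of_mem (show t - τ ∈ Ioi 0 by simpa using h2), indicator_of_mem (show τ ∈ Ioo 0 t from ⟨h1, h2⟩)]
        simp
      · rw [indicator_of_notMem (by simpa using h2), indicator_of_notMem (fun h => h2 h.2)]
    · rw [indicator_of_notMem (s := Ioo 0 t) (fun h => h1 h.1)]
      simp [indicator, Q_nonpos (not_lt.1 h1)]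
  · have h1 : 0 < t - τ := by linarith [hτ.2]
    exact mul_nonneg (hf0 _ h1) (Q_nonneg _ (by linarith [hbM _ h1]))

lemma main_norm (b f1 f2 : ℝ → ℝ) (M : ℝ) (hb : Continuous b) (hf1 : Continuous f1) (hf2 : Continuous f2)
    (hf10 : ∀ s > 0, 0 ≤ f1 s) (hf20 : ∀ s > 0, 0 ≤ f2 s) (hbM : ∀ s > 0, b s ≤ M)
    (hLip : ∀ T > 0, ∃ B ≥ (0:ℝ), ∀ s ∈ Icc 0 T, ∀ t ∈ Icc 0 T, |b t - b s| ≤ B * |t - s|)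
    (hfin : ∀ a > (0:ℝ), ∫⁻ s in Ioi (0:ℝ), ENNReal.ofReal (exp (-a^2*s/2 + a * b s) * f1 s) < ⊤)
    (heq : ∀ a > (0:ℝ), ∫⁻ s in Ioi (0:ℝ), ENNReal.ofReal (exp (-a^2*s/2 + a * b s) * f1 s)
      = ∫⁻ s in Ioi (0:ℝ), ENNReal.ofReal (exp (-a^2*s/2 + a * b s) * f2 s)) :
    ∀ t ≥ 0, f1 t = f2 t := by
  intro t1 ht1
  set T := t1 + 1 with hT
  have hT0 : 0 < T := by linarith
  obtain ⟨B, hB0, hBl⟩ := hLip T hT0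
  obtain ⟨G1, hG1⟩ := isCompact_Icc.exists_bound_of_continuousOn (hf1.continuousOn (s := Icc 0 T))
  obtain ⟨G2, hG2⟩ := isCompact_Icc.exists_bound_of_continuousOn (hf2.continuousOn (s := Icc 0 T))
  have hae : ∀ᵐ t, ∀ n : ℕ, HH b f1 (M + 1 + 1/((n:ℝ)+1)) t = HH b f2 (M + 1 + 1/((n:ℝ)+1)) t := by
    rw [ae_all_iff]
    intro n
    have : (0:ℝ) < 1/((n:ℝ)+1) := by positivity
    exact kernel_eq b f1 f2 _ M hb.measurable hf1.measurable hf2.measurable hf10 hf20 hbM (by linarith) hfin heq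
  have := gronwall (fun t => f1 t - f2 t) (by fun_prop) T B _ hT0 hB0 Q_one_pos (by
    filter_upwards [hae] with t ht htm
    have hmem : ∀ τ ∈ Ioc 0 t, t - τ ∈ Icc 0 T := fun τ hτ => ⟨by linarith [hτ.2], by linarith [hτ.1, htm.2]⟩
    have hB : ∀ τ ∈ Ioc 0 t, |b t - b (t-τ)| ≤ B * τ := by
      intro τ hτ
      have := hBl _ (hmem τ hτ) t ⟨htm.1.le, htm.2.le⟩
      rwa [sub_sub_cancel, abs_of_pos hτ.1] at this
    have hG1' : ∀ τ ∈ Ioc 0 t, |f1 (t-τ)| ≤ G1 := fun τ hτ => hG1 _ (hmem τ hτ)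
    have hG2' : ∀ τ ∈ Ioc 0 t, |f2 (t-τ)| ≤ G2 := fun τ hτ => hG2 _ (hmem τ hτ)
    have hG' : ∀ τ ∈ Ioc 0 t, |(fun s => f1 s - f2 s) (t-τ)| ≤ G1 + G2 := fun τ hτ =>
      (abs_sub _ _).trans (add_le_add (hG1' τ hτ) (hG2' τ hτ))
    have hgm : Measurable (fun s => f1 s - f2 s) := (hf1.sub hf2).measurable
    refine limit_bound b (fun s => f1 s - f2 s) hb.measurable hgm t B (G1+G2) htm.1 hB0 hB hG'
      (hf1.sub hf2).continuousAt ?_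
    intro x hx
    refine extend b _ hb.measurable hgm t B (G1+G2) M hB hG' (hbM t htm.1) (fun n => ?_) x hx
    have hxn : M < M + 1 + 1/((n:ℝ)+1) := by
      have : (0:ℝ) < 1/((n:ℝ)+1) := by positivity
      linarith
    have hbx := (hbM t htm.1).trans_lt hxn
    have e := ht n
    rw [HH_real b f1 hb.measurable hf1.measurable t B G1 M _ hf10 hbM hxn htm.1 hB hG1',
      HH_real b f2 hb.measurable hf2.measurable t B G2 M _ hf20 hbM hxn htm.1 hB hG2'] at e
    have nn : ∀ f : ℝ → ℝ, (∀ s > 0, 0 ≤ f s) → 0 ≤ ∫ τ in Ioc 0 t, f (t-τ) * Q τ (M + 1 + 1/((n:ℝ)+1) - b (t-τ)) := by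
      intro f hf
      rw [integral_Ioc_eq_integral_Ioo]
      refine setIntegral_nonneg measurableSet_Ioo fun τ hτ => ?_
      have h1 : 0 < t - τ := by linarith [hτ.2]
      exact mul_nonneg (hf _ h1) (Q_nonneg _ (by linarith [hbM _ h1]))
    rw [ENNReal.ofReal_eq_ofReal_iff (nn f1 hf10) (nn f2 hf20)] at e
    simp_rw [sub_mul]
    rw [integral_sub (real_int b f1 hb.measurable hf1.measurable t B G1 hB hG1' _ hbx)
      (real_int b f2 hb.measurable hf2.measurable t B G2 hB hG2' _ hbx), e, sub_self])
  have h := this t1 ⟨ht1, by linarith⟩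
  simpa [sub_eq_zero] using h

/-- Uniqueness of solutions to the Fredholm integral equation
`1 = ∫₀^∞ e^{-c²s/2 + c·b(s)} f(s) ds` (for all `c ≥ d`) in the class of continuous,
integrable functions that are strictly positive on `(0,∞)`. -/
theorem fredholm_uniqueness (b f ftil : ℝ → ℝ) (M m d : ℝ)
    (hb : ContDiffOn ℝ 1 b (Ici 0)) (hb0 : 0 < b 0)
    (hM : 0 < M) (hm : 0 < m) (hgrowth : ∀ t ≥ (0 : ℝ), b t ≤ M + m * t)
    (hliminf : IsBoundedUnder (· ≥ ·) (nhdsWithin 0 (Ioi 0))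
      (fun t => (b t - b 0) / t))
    (hlimsup : IsBoundedUnder (· ≤ ·) (nhdsWithin 0 (Ioi 0))
      (fun t => (b t - b 0) / t))
    (hd : 0 ≤ d)
    (hfc : ContinuousOn f (Ici 0)) (hftc : ContinuousOn ftil (Ici 0))
    (hfpos : ∀ s > (0 : ℝ), 0 < f s) (hftpos : ∀ s > (0 : ℝ), 0 < ftil s)
    (hfint : IntegrableOn f (Ici 0)) (hftint : IntegrableOn ftil (Ici 0))
    (heq : ∀ c ≥ d,
      IntegrableOn (fun s => Real.exp (-c ^ 2 * s / 2 + c * b s) * f s) (Ioi 0) ∧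
      IntegrableOn (fun s => Real.exp (-c ^ 2 * s / 2 + c * b s) * ftil s) (Ioi 0) ∧
      (∫ s in Ioi (0 : ℝ), Real.exp (-c ^ 2 * s / 2 + c * b s) * f s) = 1 ∧
      (∫ s in Ioi (0 : ℝ), Real.exp (-c ^ 2 * s / 2 + c * b s) * ftil s) = 1) :
    EqOn f ftil (Ici 0) := by
  set c0 := max d m with hc0
  have hmx : Continuous fun s : ℝ => max s 0 := by fun_prop
  have hmem : ∀ s : ℝ, max s 0 ∈ Ici (0:ℝ) := fun s => mem_Ici.2 (le_max_right _ _)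
  have hbc : Continuous fun s : ℝ => b (max s 0) := hb.continuousOn.comp_continuous hmx hmem
  have hf1c : Continuous fun s : ℝ => f (max s 0) := hfc.comp_continuous hmx hmem
  have hf2c : Continuous fun s : ℝ => ftil (max s 0) := hftc.comp_continuous hmx hmem
  let b0 : ℝ → ℝ := fun s => b (max s 0) - c0 * max s 0
  let w : ℝ → ℝ := fun s => exp (c0 * b (max s 0) - c0^2/2 * max s 0)
  have hb0c : Continuous b0 := hbc.sub (continuous_const.mul hmx)
  have hwc : Continuous w := Real.continuous_exp.comp ((continuous_const.mul hbc).sub (continuous_const.mul hmx))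
  have hLip : ∀ T > 0, ∃ B ≥ (0:ℝ), ∀ s ∈ Icc 0 T, ∀ t ∈ Icc 0 T, |b0 t - b0 s| ≤ B * |t - s| := by
    intro T hT
    have hl : LocallyLipschitzOn (Icc 0 T) b := by
      intro x hx
      have := (hb.mono (Icc_subset_Ici_self : Icc 0 T ⊆ Ici 0)) x hx
      exact this.exists_lipschitzOnWith (convex_Icc 0 T)
    obtain ⟨K, hK⟩ := hl.exists_lipschitzOnWith_of_compact isCompact_Icc
    refine ⟨K + |c0|, by positivity, fun s hs t ht => ?_⟩
    have h1 := hK.dist_le_mul t ht s hs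
    rw [Real.dist_eq, Real.dist_eq] at h1
    simp only [b0, max_eq_left hs.1, max_eq_left ht.1]
    have : b t - c0 * t - (b s - c0 * s) = (b t - b s) - c0 * (t - s) := by ring
    rw [this]
    calc _ ≤ |b t - b s| + |c0 * (t-s)| := abs_sub _ _
      _ ≤ K * |t - s| + |c0| * |t-s| := by rw [abs_mul]; gcongr
      _ = _ := by ring
  have hlin : ∀ h : ℝ → ℝ, (∀ s > 0, 0 < h s) → (∀ c ≥ d, IntegrableOn (fun s => Real.exp (-c ^ 2 * s / 2 + c * b s) * h s) (Ioi 0) ∧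
      (∫ s in Ioi (0 : ℝ), Real.exp (-c ^ 2 * s / 2 + c * b s) * h s) = 1) → ∀ a > (0:ℝ), 
      ∫⁻ s in Ioi (0:ℝ), ENNReal.ofReal (exp (-a^2*s/2 + a * b0 s) * (w s * h (max s 0))) = 1 := by
    intro h hpos hh a ha
    obtain ⟨h1, h2⟩ := hh (a + c0) (by have := le_max_left d m; linarith)
    rw [← ENNReal.ofReal_one, ← h2, ofReal_integral_eq_lintegral_ofReal h1 
      ((ae_restrict_iff' measurableSet_Ioi).2 (ae_of_all _ fun s hs => mul_nonneg (exp_pos _).le (hpos s hs).le))]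
    refine setLIntegral_congr_fun measurableSet_Ioi fun s hs => ?_
    have hs : 0 < s := hs
    simp only [b0, w, max_eq_left hs.le]
    rw [← mul_assoc, ← exp_add]
    congr 3
    ring
  have hL1 := hlin f hfpos (fun c hc => ⟨(heq c hc).1, (heq c hc).2.2.1⟩)
  have hL2 := hlin ftil hftpos (fun c hc => ⟨(heq c hc).2.1, (heq c hc).2.2.2⟩)
  have key := main_norm b0 (fun s => w s * f (max s 0)) (fun s => w s * ftil (max s 0)) M hb0c
    (hwc.mul hf1c) (hwc.mul hf2c) 
    (fun s hs => mul_nonneg (exp_pos _).le (by rw [max_eq_left hs.le]; exact (hfpos s hs).le))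
    (fun s hs => mul_nonneg (exp_pos _).le (by rw [max_eq_left hs.le]; exact (hftpos s hs).le))
    (fun s hs => by
      simp only [b0, max_eq_left hs.le]
      have h1 := hgrowth s hs.le
      have h2 : m * s ≤ c0 * s := mul_le_mul_of_nonneg_right (le_max_right d m) hs.le
      linarith) hLip (fun a ha => by rw [hL1 a ha]; exact ENNReal.one_lt_top)
    (fun a ha => by rw [hL1 a ha, hL2 a ha])
  intro t ht
  have := key t ht
  simp only [max_eq_left (show (0:ℝ) ≤ t from ht)] at this
  exact mul_left_cancel₀ (exp_pos _).ne' this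
end

section
/- Let b : [0,∞) → ℝ be continuously differentiable, Lipschitz continuous, with linear growth (there exist M, m > 0 with b(t) ≤ M + m·t for all t ≥ 0), and let f, f̃ : [0,∞) → ℝ be continuous, integrable functions, strictly positive on (0,∞). If there is a constant C > 0 such that ∫₀^∞ e^{-c²s/2 + c·b(s)} f(s) ds = ∫₀^∞ e^{-c²s/2 + c·b(s)} f̃(s) ds for all c > C, then for every n ∈ ℕ and every c > C for which the integrals exist, ∫₀^∞ e^{-c²s/2 + c·b(s)} sⁿ f(s) ds = ∫₀^∞ e^{-c²s/2 + c·b(s)} sⁿ f̃(s) ds. -/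
open MeasureTheory Real Filter Set

lemma fr_holo (p q g : ℝ → ℝ) (ν : Measure ℝ) (hp : AEStronglyMeasurable p ν)
    (hq : AEStronglyMeasurable q ν) (hg : Integrable g ν) (U : Set ℂ)
    (hbd : ∀ c₀ ∈ U, ∃ r > 0, ∃ M : ℝ, ∀ᵐ s ∂ν, ∀ c ∈ Metric.closedBall c₀ r,
      ‖Complex.exp (c ^ 2 * (p s : ℂ) + c * (q s : ℂ))‖ ≤ M) :
    DifferentiableOn ℂ
      (fun c : ℂ => ∫ s, Complex.exp (c ^ 2 * (p s : ℂ) + c * (q s : ℂ)) * (g s : ℂ) ∂ν) U := by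
  intro c₀ hc₀
  obtain ⟨r, hr, M, hM⟩ := hbd c₀ hc₀
  have hpc : AEStronglyMeasurable (fun s => (p s : ℂ)) ν :=
    Complex.continuous_ofReal.comp_aestronglyMeasurable hp
  have hqc : AEStronglyMeasurable (fun s => (q s : ℂ)) ν :=
    Complex.continuous_ofReal.comp_aestronglyMeasurable hq
  have hgc : AEStronglyMeasurable (fun s => (g s : ℂ)) ν :=
    Complex.continuous_ofReal.comp_aestronglyMeasurable hg.1
  have hem : ∀ c : ℂ, AEStronglyMeasurable
      (fun s => Complex.exp (c ^ 2 * (p s : ℂ) + c * (q s : ℂ))) ν := fun c =>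
    Complex.continuous_exp.comp_aestronglyMeasurable ((hpc.const_mul _).add (hqc.const_mul _))
  have hd : ∀ s (c : ℂ), HasDerivAt
      (fun c : ℂ => Complex.exp (c ^ 2 * (p s : ℂ) + c * (q s : ℂ)))
      (Complex.exp (c ^ 2 * (p s : ℂ) + c * (q s : ℂ)) * (2 * c * (p s : ℂ) + (q s : ℂ))) c := by
    intro s c
    have h1 : HasDerivAt (fun c : ℂ => c ^ 2 * (p s : ℂ) + c * (q s : ℂ))
        (2 * c * (p s : ℂ) + (q s : ℂ)) c := by
      have := ((hasDerivAt_pow 2 c).mul_const (p s : ℂ)).add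
        ((hasDerivAt_id c).mul_const (q s : ℂ))
      refine HasDerivAt.congr_deriv this ?_
      simp
    exact h1.cexp
  have key := hasDerivAt_integral_of_dominated_loc_of_deriv_le (𝕜 := ℂ) (μ := ν) (x₀ := c₀)
    (s := Metric.ball c₀ (r / 2))
    (F := fun c s => Complex.exp (c ^ 2 * (p s : ℂ) + c * (q s : ℂ)) * (g s : ℂ))
    (F' := fun c s => (Complex.exp (c ^ 2 * (p s : ℂ) + c * (q s : ℂ)) *
      (2 * c * (p s : ℂ) + (q s : ℂ))) * (g s : ℂ))
    (bound := fun s => M / (r / 2) * ‖g s‖)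
    (Metric.ball_mem_nhds _ (by positivity))
    (Eventually.of_forall fun c => (hem c).mul hgc)
    ?_ ?_ ?_ (hg.norm.const_mul _) ?_
  · exact key.2.differentiableAt.differentiableWithinAt
  · refine (hg.norm.const_mul M).mono' ((hem _).mul hgc) ?_
    filter_upwards [hM] with s hs
    rw [norm_mul, Complex.norm_real]
    exact mul_le_mul_of_nonneg_right (hs _ (Metric.mem_closedBall_self hr.le)) (norm_nonneg _)
  · exact ((hem _).mul ((hpc.const_mul _).add hqc)).mul hgc
  · filter_upwards [hM] with s hs c hc
    rw [norm_mul, Complex.norm_real]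
    refine mul_le_mul_of_nonneg_right ?_ (norm_nonneg _)
    rw [← (hd s c).deriv]
    refine Complex.norm_deriv_le_of_forall_mem_sphere_norm_le (by positivity) ?_ ?_
    · have : Differentiable ℂ (fun c : ℂ => Complex.exp (c ^ 2 * (p s : ℂ) + c * (q s : ℂ))) :=
        fun c => (hd s c).differentiableAt
      exact this.diffContOnCl
    · intro z hz
      apply hs
      rw [Metric.mem_closedBall]
      have h1 : dist z c = r / 2 := hz
      have h2 : dist c c₀ < r / 2 := hc
      linarith [dist_triangle z c c₀]
  · exact Eventually.of_forall fun s c _ => (hd s c).mul_const _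

/-- rectangle contour -/
lemma fr_cauchy (h : ℂ → ℂ) (hd : Differentiable ℂ h ∨ DifferentiableOn ℂ h {z | 0 ≤ z.re})
    (A : ℝ) (hA : ∀ z : ℂ, 0 ≤ z.re → ‖h z‖ ≤ A / ‖1 + z‖ ^ 2)
    (hi : Integrable (fun y : ℝ => h (y * Complex.I))) :
    ∫ y : ℝ, h (y * Complex.I) = 0 := by
  have hd' : DifferentiableOn ℂ h {z | 0 ≤ z.re} := by
    rcases hd with hd | hd
    · exact hd.differentiableOn
    · exact hd
  have hA0 : 0 ≤ A := by
    have := (norm_nonneg _).trans (hA 0 (by simp))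
    simpa using this
  have hlim := intervalIntegral_tendsto_integral hi tendsto_neg_atTop_atBot tendsto_id
  have hz : Tendsto (fun R : ℝ => ∫ y in (-R)..R, h (y * Complex.I)) atTop (nhds 0) := by
    refine squeeze_zero_norm' (a := fun R => 4 * A * R⁻¹) ?_ ?_
    · filter_upwards [eventually_gt_atTop (0 : ℝ)] with R hR
      have hrect := Complex.integral_boundary_rect_eq_zero_of_differentiableOn h
        (-(R : ℂ) * Complex.I) (R + R * Complex.I) (hd'.mono ?_)
      · simp only [Complex.mul_re, Complex.add_re, Complex.neg_re, Complex.ofReal_re,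
          Complex.I_re, mul_zero, Complex.neg_im, Complex.ofReal_im, Complex.I_im, mul_one,
          neg_zero, add_zero, Complex.add_im, Complex.mul_im, zero_add,
          Complex.ofReal_zero, sub_self, smul_eq_mul, Complex.ofReal_neg] at hrect
        have hnb : ∀ z : ℂ, 0 ≤ z.re → R ≤ ‖z‖ → ‖h z‖ ≤ A / R ^ 2 := by
          intro z hz hzR
          refine (hA z hz).trans ?_
          gcongr
          refine hzR.trans ?_
          rw [← sq_le_sq₀ (norm_nonneg _) (norm_nonneg _), ← Complex.normSq_eq_norm_sq,
            ← Complex.normSq_eq_norm_sq, Complex.normSq_apply, Complex.normSq_apply]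
          simp; nlinarith
        have b1 : ‖∫ x in (0:ℝ)..R, h (x + -(R:ℂ) * Complex.I)‖ ≤ A / R ^ 2 * |R - 0| := by
          refine intervalIntegral.norm_integral_le_of_norm_le_const fun x hx => ?_
          rw [uIoc_of_le hR.le] at hx
          apply hnb
          · simp; exact hx.1.le
          · refine le_trans ?_ (Complex.abs_im_le_norm _)
            simp [abs_of_pos hR]
        have b2 : ‖∫ x in (0:ℝ)..R, h (x + (R:ℂ) * Complex.I)‖ ≤ A / R ^ 2 * |R - 0| := by
          refine intervalIntegral.norm_integral_le_of_norm_le_const fun x hx => ?_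
          rw [uIoc_of_le hR.le] at hx
          apply hnb
          · simp; exact hx.1.le
          · refine le_trans ?_ (Complex.abs_im_le_norm _)
            simp [abs_of_pos hR]
        have b3 : ‖∫ y in (-R)..R, h (R + (y:ℂ) * Complex.I)‖ ≤ A / R ^ 2 * |R - -R| := by
          refine intervalIntegral.norm_integral_le_of_norm_le_const fun x hx => ?_
          apply hnb
          · simp; exact hR.le
          · refine le_trans ?_ (Complex.abs_re_le_norm _)
            simp [abs_of_pos hR]
        have e0 : Complex.I * ∫ y in (-R)..R, h (y * Complex.I)
            = (∫ x in (0:ℝ)..R, h (x + -(R:ℂ) * Complex.I))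
              - (∫ x in (0:ℝ)..R, h (x + (R:ℂ) * Complex.I))
              + Complex.I * ∫ y in (-R)..R, h (R + (y:ℂ) * Complex.I) := by
          linear_combination -hrect
        have e1 : ‖∫ y in (-R)..R, h (y * Complex.I)‖
            = ‖Complex.I * ∫ y in (-R)..R, h (y * Complex.I)‖ := by simp
        rw [e1, e0]
        refine (norm_add_le _ _).trans ?_
        rw [norm_mul, Complex.norm_I, one_mul]
        have := norm_sub_le (∫ x in (0:ℝ)..R, h (x + -(R:ℂ) * Complex.I))
          (∫ x in (0:ℝ)..R, h (x + (R:ℂ) * Complex.I))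
        have q1 : |R - 0| = R := by rw [sub_zero, abs_of_pos hR]
        have q2 : |R - -R| = 2 * R := by rw [abs_of_pos] <;> linarith
        rw [q1] at b1 b2
        rw [q2] at b3
        have : 4 * A * R⁻¹ = A / R ^ 2 * R + A / R ^ 2 * R + A / R ^ 2 * (2 * R) := by
          field_simp; ring
        linarith
      · intro z hz
        have := hz.1
        simp [uIcc_of_le hR.le] at this
        exact this.1
    · simpa using (tendsto_inv_atTop_zero (𝕜 := ℝ)).const_mul (4 * A)
  exact tendsto_nhds_unique hlim hz

noncomputable def frE (β : ℝ → ℝ) (t : ℝ) (c : ℂ) (s : ℝ) : ℂ :=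
  Complex.exp (c ^ 2 * (((t - s) / 2 : ℝ) : ℂ) + c * ((β s - β t : ℝ) : ℂ))

lemma frE_norm (β : ℝ → ℝ) (t : ℝ) (c : ℂ) (s : ℝ) :
    ‖frE β t c s‖ =
      Real.exp ((c.re ^ 2 - c.im ^ 2) * ((t - s) / 2) + c.re * (β s - β t)) := by
  rw [frE, Complex.norm_exp]
  congr 1
  simp only [Complex.add_re, pow_two, Complex.mul_re, Complex.ofReal_re, Complex.ofReal_im,
    mul_zero, sub_zero]

noncomputable def frL (β G : ℝ → ℝ) (a t : ℝ) (c : ℂ) : ℂ :=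
  ∫ s in Ioc a t, frE β t c s * (G s : ℂ)

noncomputable def frR (β G : ℝ → ℝ) (t : ℝ) (c : ℂ) : ℂ :=
  ∫ s in Ioi t, frE β t c s * (G s : ℂ)

/-- The standing hypotheses. -/
structure FrH (β G : ℝ → ℝ) (a K : ℝ) : Prop where
  hK : 0 ≤ K
  hβc : ContinuousOn β (Ici a)
  anti : ∀ s s', a ≤ s → s ≤ s' → β s' ≤ β s
  lip : ∀ s s', a ≤ s → s ≤ s' → β s - β s' ≤ K * (s' - s)
  hGc : ContinuousOn G (Ici a)
  hGi : IntegrableOn G (Ioi a)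

lemma fr_expint (a t l : ℝ) (hat : a < t) (hl : 0 ≤ l) :
    ∫ s in Ioc a t, Real.exp (-l * (t - s)) ≤ 2 * (t - a) / (1 + (t - a) * l) := by
  have hT : 0 < t - a := sub_pos.2 hat
  have h1 : ∫ s in Ioc a t, Real.exp (-l * (t - s)) ≤ t - a := by
    have := setIntegral_mono_on (μ := volume) (s := Ioc a t)
      (f := fun s => Real.exp (-l * (t - s))) (g := fun _ => (1 : ℝ))
      ((by fun_prop : Continuous fun s => Real.exp (-l * (t - s))).integrableOn_Ioc)
      (integrableOn_const (by simp)) measurableSet_Ioc (fun s hs => by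
        rw [Real.exp_le_one_iff]
        nlinarith [hs.2])
    refine this.trans ?_
    simp [hat.le]
  have h2 : l * ∫ s in Ioc a t, Real.exp (-l * (t - s)) ≤ 1 := by
    rw [← intervalIntegral.integral_of_le hat.le, ← intervalIntegral.integral_const_mul]
    rw [intervalIntegral.integral_eq_sub_of_hasDerivAt (f := fun s => Real.exp (-l * (t - s)))]
    · have := Real.exp_pos (-l * (t - a))
      simp
      simpa using this.le
    · intro x _
      have : HasDerivAt (fun s => -l * (t - s)) l x := by
        simpa using ((hasDerivAt_id x).const_sub t).const_mul (-l)
      simpa [mul_comm] using this.exp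
    · exact (by fun_prop : Continuous fun s => l * Real.exp (-l * (t - s))).intervalIntegrable _ _
  rw [le_div_iff₀ (by positivity)]
  nlinarith

section
variable {β G : ℝ → ℝ} {a K t : ℝ}

lemma FrH.frE_meas (H : FrH β G a K) (t : ℝ) (c : ℂ) :
    AEStronglyMeasurable (frE β t c) (volume.restrict (Ici a)) := by
  have h : ContinuousOn (frE β t c) (Ici a) := by
    unfold frE
    have := H.hβc
    fun_prop
  exact h.aestronglyMeasurable measurableSet_Ici

lemma fr_sub1 (_hat : a ≤ t) : Ioc a t ⊆ Ici a := fun _ hs => hs.1.le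
lemma fr_sub2 (hat : a ≤ t) : Ioi t ⊆ Ici a := fun _ hs => hat.trans (le_of_lt hs)

lemma FrH.integ (H : FrH β G a K) (t : ℝ) (c : ℂ) (A : Set ℝ) (hA : MeasurableSet A)
    (hAs : A ⊆ Ioi a) (M : ℝ) (hM : ∀ s ∈ A, ‖frE β t c s‖ ≤ M) :
    IntegrableOn (fun s => frE β t c s * (G s : ℂ)) A := by
  have hG := (H.hGi.mono_set hAs)
  refine (hG.norm.const_mul M).mono' ?_ ?_
  · exact ((H.frE_meas t c).mono_measure (Measure.restrict_mono (hAs.trans Ioi_subset_Ici_self) le_rfl)).mul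
      (Complex.continuous_ofReal.comp_aestronglyMeasurable hG.1)
  · filter_upwards [ae_restrict_mem hA] with s hs
    rw [norm_mul, Complex.norm_real]
    exact mul_le_mul_of_nonneg_right (hM s hs) (norm_nonneg _)

lemma FrH.left_bd (H : FrH β G a K) (c : ℂ) {s : ℝ} (hs : s ∈ Ioc a t) :
    ‖frE β t c s‖ ≤ Real.exp (‖c‖ ^ 2 * ((t - a) / 2) + ‖c‖ * (K * (t - a))) := by
  rw [frE_norm, Real.exp_le_exp]
  have h1 := H.lip s t hs.1.le hs.2
  have h0 := H.anti s t hs.1.le hs.2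
  have hn : c.re ^ 2 - c.im ^ 2 ≤ ‖c‖ ^ 2 := by
    rw [← Complex.normSq_eq_norm_sq, Complex.normSq_apply]; nlinarith
  have hr := Complex.re_le_norm c
  have hK := H.hK
  have : β s - β t ≤ K * (t - a) := h1.trans (by nlinarith [hs.1])
  have q1 : (c.re ^ 2 - c.im ^ 2) * ((t - s) / 2) ≤ ‖c‖ ^ 2 * ((t - a) / 2) := by
    refine (mul_le_mul_of_nonneg_right hn (by linarith [hs.2])).trans ?_
    exact mul_le_mul_of_nonneg_left (by linarith [hs.1]) (by positivity)
  have q2 : c.re * (β s - β t) ≤ ‖c‖ * (K * (t - a)) := by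
    refine (mul_le_mul_of_nonneg_right hr (by linarith)).trans ?_
    exact mul_le_mul_of_nonneg_left this (by positivity)
  linarith

lemma FrH.right_bd (H : FrH β G a K) (hat : a < t) {c : ℂ} (hc : |c.im| < c.re) {s : ℝ}
    (hs : s ∈ Ioi t) : ‖frE β t c s‖ ≤ 1 := by
  rw [frE_norm, Real.exp_le_one_iff]
  have h0 := H.anti t s hat.le (le_of_lt hs)
  have hre : 0 < c.re := (abs_nonneg _).trans_lt hc
  have h1 : c.im ^ 2 ≤ c.re ^ 2 := sq_le_sq.2 (by rw [abs_of_pos hre]; exact hc.le)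
  have hs' : t < s := hs
  nlinarith

lemma FrH.L_diff (H : FrH β G a K) (hat : a < t) : Differentiable ℂ (frL β G a t) := by
  rw [← differentiableOn_univ]
  refine fr_holo (fun s => (t - s) / 2) (fun s => β s - β t) G (volume.restrict (Ioc a t))
    (by fun_prop) ?_ (H.hGi.mono_set Ioc_subset_Ioi_self) univ ?_
  · exact ((H.hβc.mono (fr_sub1 hat.le)).sub continuousOn_const).aestronglyMeasurable
      measurableSet_Ioc
  · intro c₀ _
    refine ⟨1, one_pos,
      Real.exp ((‖c₀‖ + 1) ^ 2 * ((t - a) / 2) + (‖c₀‖ + 1) * (K * (t - a))), ?_⟩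
    filter_upwards [ae_restrict_mem measurableSet_Ioc] with s hs c hc
    have hcn : ‖c‖ ≤ ‖c₀‖ + 1 := by
      have : ‖c - c₀‖ ≤ 1 := by simpa [dist_eq_norm] using hc
      have := norm_le_norm_add_norm_sub' c c₀
      linarith
    refine (H.left_bd c hs).trans ?_
    rw [Real.exp_le_exp]
    have := H.hK
    have h2 : 0 < t - a := sub_pos.2 hat
    gcongr

def frQ : Set ℂ := {c | |c.im| < c.re}

lemma frQ_open : IsOpen frQ :=
  isOpen_lt (by fun_prop) (by fun_prop)

lemma frQ_convex : Convex ℝ frQ := by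
  intro x hx y hy u v hu hv huv
  simp only [frQ, mem_ofPred_eq] at *
  rw [abs_lt] at *
  simp only [Complex.add_im, Complex.add_re, Complex.real_smul, Complex.mul_re, Complex.mul_im,
    Complex.ofReal_re, Complex.ofReal_im, zero_mul, sub_zero, add_zero]
  have hv' : v = 1 - u := by linarith
  rcases eq_or_lt_of_le hu with h | h
  · subst h
    have : v = 1 := by linarith
    subst this
    constructor <;> linarith
  · constructor
    · nlinarith [mul_lt_mul_of_pos_left hx.1 h, mul_le_mul_of_nonneg_left hy.1.le hv]
    · nlinarith [mul_lt_mul_of_pos_left hx.2 h, mul_le_mul_of_nonneg_left hy.2.le hv]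

lemma FrH.R_diff (H : FrH β G a K) (hat : a < t) : DifferentiableOn ℂ (frR β G t) frQ := by
  refine fr_holo (fun s => (t - s) / 2) (fun s => β s - β t) G (volume.restrict (Ioi t))
    (by fun_prop) ?_ (H.hGi.mono_set (Ioi_subset_Ioi hat.le)) frQ ?_
  · exact ((H.hβc.mono (fr_sub2 hat.le)).sub continuousOn_const).aestronglyMeasurable
      measurableSet_Ioi
  · intro c₀ hc₀
    obtain ⟨r, hr, hsub⟩ := Metric.nhds_basis_closedBall.mem_iff.1 (frQ_open.mem_nhds hc₀)
    refine ⟨r, hr, 1, ?_⟩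
    filter_upwards [ae_restrict_mem measurableSet_Ioi] with s hs c hc
    exact H.right_bd hat (hsub hc) hs

lemma FrH.L_eq_real (H : FrH β G a K) (hat : a < t) {c : ℝ} (hc0 : 0 < c)
    (h0 : ∫ s in Ioi a, Real.exp (-c ^ 2 * s / 2 + c * β s) * G s = 0) :
    frL β G a t c = - frR β G t c := by
  have hu : Ioc a t ∪ Ioi t = Ioi a := Ioc_union_Ioi_eq_Ioi hat.le
  have hsum : frL β G a t c + frR β G t c = ∫ s in Ioi a, frE β t c s * (G s : ℂ) := by
    rw [← hu, setIntegral_union (by rw [Set.disjoint_left]; intro x hx hx'; exact absurd hx.2 (not_le.2 hx'))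
      measurableSet_Ioi]
    · rfl
    · exact H.integ t c _ measurableSet_Ioc Ioc_subset_Ioi_self _ fun s hs => H.left_bd _ hs
    · exact H.integ t c _ measurableSet_Ioi (Ioi_subset_Ioi hat.le) 1
        fun s hs => H.right_bd hat (by simpa using hc0) hs
  have : ∫ s in Ioi a, frE β t c s * (G s : ℂ)
      = ((Real.exp (c ^ 2 * t / 2 - c * β t) *
        ∫ s in Ioi a, Real.exp (-c ^ 2 * s / 2 + c * β s) * G s : ℝ) : ℂ) := by
    rw [← integral_const_mul, ← integral_complex_ofReal]
    congr 1
    ext s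
    rw [frE, ← mul_assoc, ← Real.exp_add]
    push_cast
    congr 2
    ring
  rw [this, h0] at hsum
  simp at hsum
  exact eq_neg_of_add_eq_zero_left hsum

lemma FrH.L_eq (H : FrH β G a K) (hat : a < t) (C : ℝ)
    (h0 : ∀ c > C, ∫ s in Ioi a, Real.exp (-c ^ 2 * s / 2 + c * β s) * G s = 0) :
    EqOn (frL β G a t) (fun c => - frR β G t c) frQ := by
  have hz : ((|C| + 1 : ℝ) : ℂ) ∈ frQ := by
    simp only [frQ, mem_ofPred_eq, Complex.ofReal_im, Complex.ofReal_re, abs_zero]; positivity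
  refine AnalyticOnNhd.eqOn_of_preconnected_of_frequently_eq
    ((H.L_diff hat).differentiableOn.analyticOnNhd frQ_open)
    ((H.R_diff hat).neg.analyticOnNhd frQ_open) frQ_convex.isPreconnected hz ?_
  have hf : ∃ᶠ x : ℝ in nhdsWithin (|C| + 1) {(|C| + 1)}ᶜ, |C| < x := by
    apply Eventually.frequently
    exact nhdsWithin_le_nhds (lt_mem_nhds (by linarith))
  have ht : Tendsto (fun x : ℝ => (x : ℂ)) (nhdsWithin (|C| + 1) {(|C| + 1)}ᶜ)
      (nhdsWithin ((|C| + 1 : ℝ) : ℂ) {((|C| + 1 : ℝ) : ℂ)}ᶜ) := by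
    refine Complex.continuous_ofReal.continuousWithinAt.tendsto_nhdsWithin ?_
    intro x hx
    simpa only [mem_compl_iff, mem_singleton_iff, Complex.ofReal_inj] using hx
  refine ht.frequently (hf.mono fun x hx => ?_)
  exact H.L_eq_real hat ((abs_nonneg _).trans_lt hx) (h0 x ((le_abs_self _).trans_lt hx))

end

section
variable {β G : ℝ → ℝ} {a K t S : ℝ}

lemma FrH.L_im (_H : FrH β G a K) (hat : a < t) (hS : ∀ s ∈ Icc a t, |G s| ≤ S) (y : ℝ) :
    ‖frL β G a t (y * Complex.I)‖ ≤ S * (2 * (t - a) / (1 + (t - a) * (y ^ 2 / 2))) := by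
  have hS0 : 0 ≤ S := (abs_nonneg _).trans (hS a ⟨le_rfl, hat.le⟩)
  refine (norm_integral_le_of_norm_le
    (g := fun s => S * Real.exp (-(y ^ 2 / 2) * (t - s))) ?_ ?_).trans ?_
  · exact (by fun_prop : Continuous fun s => S * Real.exp (-(y ^ 2 / 2) * (t - s))).integrableOn_Ioc
  · filter_upwards [ae_restrict_mem measurableSet_Ioc] with s hs
    rw [norm_mul, frE_norm, Complex.norm_real, mul_comm]
    refine mul_le_mul (hS s ⟨hs.1.le, hs.2⟩) ?_ (Real.exp_pos _).le hS0
    rw [Real.exp_le_exp]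
    simp
    linarith
  · rw [integral_const_mul]
    exact mul_le_mul_of_nonneg_left (fr_expint a t _ hat (by positivity)) hS0

lemma FrH.L_growth (H : FrH β G a K) (hat : a < t)
    (hQ : EqOn (frL β G a t) (fun c => - frR β G t c) frQ) {c : ℂ} (hc : 0 < c.re) :
    ‖frL β G a t c‖ ≤ (∫ s in Ioi a, ‖G s‖) * Real.exp (K * (t - a) * ‖c‖) := by
  have hK := H.hK
  have hT : 0 < t - a := sub_pos.2 hat
  have hA : 0 ≤ ∫ s in Ioi a, ‖G s‖ := integral_nonneg fun _ => norm_nonneg _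
  by_cases hcQ : c ∈ frQ
  · rw [hQ hcQ, norm_neg]
    have h1 : ‖frR β G t c‖ ≤ ∫ s in Ioi t, ‖G s‖ := by
      refine norm_integral_le_of_norm_le (H.hGi.mono_set (Ioi_subset_Ioi hat.le)).norm ?_
      filter_upwards [ae_restrict_mem measurableSet_Ioi] with s hs
      rw [norm_mul, Complex.norm_real]
      exact mul_le_of_le_one_left (norm_nonneg _) (H.right_bd hat hcQ hs)
    have h2 : ∫ s in Ioi t, ‖G s‖ ≤ ∫ s in Ioi a, ‖G s‖ :=
      setIntegral_mono_set H.hGi.norm (Eventually.of_forall fun _ => norm_nonneg _)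
        (Ioi_subset_Ioi hat.le).eventuallyLE
    refine (h1.trans h2).trans (le_mul_of_one_le_right hA ?_)
    rw [Real.one_le_exp_iff]; positivity
  · have hcQ' : c.re ≤ |c.im| := by simpa [frQ] using hcQ
    have hsq : c.re ^ 2 ≤ c.im ^ 2 := by rw [sq_le_sq, abs_of_pos hc]; exact hcQ'
    have h1 : ‖frL β G a t c‖ ≤ ∫ s in Ioc a t, Real.exp (K * (t - a) * ‖c‖) * ‖G s‖ := by
      refine norm_integral_le_of_norm_le
        ((H.hGi.mono_set Ioc_subset_Ioi_self).norm.const_mul _) ?_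
      filter_upwards [ae_restrict_mem measurableSet_Ioc] with s hs
      rw [norm_mul, Complex.norm_real]
      refine mul_le_mul_of_nonneg_right ?_ (norm_nonneg _)
      rw [frE_norm, Real.exp_le_exp]
      have h1 := H.lip s t hs.1.le hs.2
      have h2 : β s - β t ≤ K * (t - a) := h1.trans (by nlinarith [hs.1])
      have h3 := Complex.re_le_norm c
      have h4 : c.re * (β s - β t) ≤ ‖c‖ * (K * (t - a)) := by
        refine (mul_le_mul_of_nonneg_left h2 hc.le).trans ?_
        exact mul_le_mul_of_nonneg_right h3 (by positivity)
      nlinarith [hs.2]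
    rw [integral_const_mul] at h1
    have h2 : ∫ s in Ioc a t, ‖G s‖ ≤ ∫ s in Ioi a, ‖G s‖ :=
      setIntegral_mono_set H.hGi.norm (Eventually.of_forall fun _ => norm_nonneg _)
        Ioc_subset_Ioi_self.eventuallyLE
    refine h1.trans ?_
    rw [mul_comm]
    exact mul_le_mul_of_nonneg_right h2 (Real.exp_pos _).le

lemma FrH.L_real (H : FrH β G a K) (hat : a < t)
    (hQ : EqOn (frL β G a t) (fun c => - frR β G t c) frQ) :
    ∃ B : ℝ, ∀ x : ℝ, 1 ≤ x → x ^ 2 * ‖frL β G a t x‖ ≤ B := by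
  obtain ⟨S', hS'⟩ := (isCompact_Icc (a := t) (b := t + 1)).exists_bound_of_continuousOn
    (H.hGc.mono (fun s hs => hat.le.trans hs.1))
  have hS0 : 0 ≤ S' := (norm_nonneg _).trans (hS' t ⟨le_rfl, by linarith⟩)
  have hGt := (H.hGi.mono_set (Ioi_subset_Ioi hat.le)).norm
  refine ⟨2 * S' + 2 * ∫ s in Ioi t, ‖G s‖, fun x hx => ?_⟩
  have hx0 : 0 < x := by linarith
  have hxQ : (x : ℂ) ∈ frQ := by simpa [frQ] using hx0
  have hneg : -(x ^ 2 / 2) < 0 := by have : 0 < x ^ 2 := by positivity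
                                     linarith
  rw [hQ hxQ, norm_neg]
  have e1 : x ^ 2 * ‖frR β G t x‖ = ‖∫ s in Ioi t, ((x ^ 2 : ℝ) : ℂ) * (frE β t x s * (G s : ℂ))‖ := by
    rw [integral_const_mul, norm_mul, Complex.norm_real, Real.norm_of_nonneg (by positivity)]
    rfl
  rw [e1]
  have hi : IntegrableOn (fun s => S' * x ^ 2 * Real.exp (x ^ 2 / 2 * t) *
      Real.exp (-(x ^ 2 / 2) * s)) (Ioi t) := (integrableOn_exp_mul_Ioi hneg t).const_mul _
  refine (norm_integral_le_of_norm_le (μ := volume.restrict (Ioi t))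
    (g := fun s => S' * x ^ 2 * Real.exp (x ^ 2 / 2 * t) * Real.exp (-(x ^ 2 / 2) * s)
      + 2 * ‖G s‖) (Integrable.add hi (hGt.const_mul 2)) ?_).trans ?_
  · filter_upwards [ae_restrict_mem measurableSet_Ioi] with s hs
    have hs' : t < s := hs
    rw [norm_mul, norm_mul, Complex.norm_real, Complex.norm_real,
      Real.norm_of_nonneg (by positivity : 0 ≤ x ^ 2), frE_norm, mul_assoc _ (rexp _) (rexp _),
      ← Real.exp_add]
    have hexp : (((x:ℂ).re ^ 2 - (x:ℂ).im ^ 2) * ((t - s) / 2) + (x:ℂ).re * (β s - β t))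
        ≤ x ^ 2 / 2 * t + -(x ^ 2 / 2) * s := by
      have h0 := H.anti t s hat.le hs'.le
      simp only [Complex.ofReal_re, Complex.ofReal_im]
      nlinarith
    have hexp' := Real.exp_le_exp.2 hexp
    have hG0 := norm_nonneg (G s)
    refine (mul_le_mul_of_nonneg_left (mul_le_mul_of_nonneg_right hexp' hG0)
      (by positivity : 0 ≤ x ^ 2)).trans ?_
    rcases le_total s (t + 1) with h | h
    · have := hS' s ⟨hs'.le, h⟩
      have h2 : x ^ 2 * (rexp (x ^ 2 / 2 * t + -(x ^ 2 / 2) * s) * ‖G s‖) ≤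
          x ^ 2 * (rexp (x ^ 2 / 2 * t + -(x ^ 2 / 2) * s) * S') := by gcongr
      nlinarith
    · have h3 : x ^ 2 * rexp (x ^ 2 / 2 * t + -(x ^ 2 / 2) * s) ≤ 2 := by
        have h5 : rexp (x ^ 2 / 2 * t + -(x ^ 2 / 2) * s) ≤ rexp (-(x ^ 2 / 2)) := by
          rw [Real.exp_le_exp]; nlinarith [sq_nonneg x]
        have h6 := Real.add_one_le_exp (x ^ 2 / 2)
        have h7 : rexp (-(x ^ 2 / 2)) * rexp (x ^ 2 / 2) = 1 := by rw [← Real.exp_add]; simp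
        have h8 := Real.exp_pos (-(x ^ 2 / 2))
        have : x ^ 2 * rexp (-(x ^ 2 / 2)) ≤ 2 := by nlinarith
        exact (mul_le_mul_of_nonneg_left h5 (by positivity)).trans this
      have h4 : 0 ≤ S' * x ^ 2 * rexp (x ^ 2 / 2 * t + -(x ^ 2 / 2) * s) := by positivity
      rw [← mul_assoc]
      nlinarith [mul_le_mul_of_nonneg_right h3 hG0]
  · rw [integral_add hi (hGt.const_mul 2), integral_const_mul, integral_const_mul,
      integral_exp_mul_Ioi hneg]
    have : S' * x ^ 2 * rexp (x ^ 2 / 2 * t) * (-rexp (-(x ^ 2 / 2) * t) / -(x ^ 2 / 2))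
        = 2 * S' := by
      rw [neg_mul, Real.exp_neg]
      field_simp
    rw [this]

lemma FrH.L_PL (H : FrH β G a K) (hat : a < t) (hS : ∀ s ∈ Icc a t, |G s| ≤ S)
    (hQ : EqOn (frL β G a t) (fun c => - frR β G t c) frQ) :
    ∃ A : ℝ, ∀ z : ℂ, 0 ≤ z.re → ‖frL β G a t z‖ ≤ A / ‖1 + z‖ ^ 2 := by
  have hT : 0 < t - a := sub_pos.2 hat
  have hS0 : 0 ≤ S := (abs_nonneg _).trans (hS a ⟨le_rfl, hat.le⟩)
  refine ⟨S * (2 * (t - a) + 4), fun z hz => ?_⟩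
  have hne : 1 + z ≠ 0 := by
    intro h
    have := congrArg Complex.re h
    simp at this; linarith
  rw [le_div_iff₀ (by positivity), mul_comm, ← norm_pow, ← norm_mul]
  refine PhragmenLindelof.right_half_plane_of_bounded_on_real
    (f := fun z => (1 + z) ^ 2 * frL β G a t z) ?_ ?_ ?_ ?_ hz
  · have := H.L_diff hat
    exact (by fun_prop : Differentiable ℂ fun z => (1 + z) ^ 2 * frL β G a t z).diffContOnCl
  · refine ⟨1, by norm_num, K * (t - a) + 2, ?_⟩
    refine Asymptotics.IsBigO.of_bound (∫ s in Ioi a, ‖G s‖) ?_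
    refine Filter.mem_inf_of_right ?_
    intro c hc
    have hc' : 0 < c.re := hc
    have h1 := H.L_growth hat hQ hc'
    show ‖(1 + c) ^ 2 * frL β G a t c‖ ≤ _
    rw [norm_mul, norm_pow, Real.rpow_one, Real.norm_of_nonneg (Real.exp_pos _).le]
    have h2 : ‖1 + c‖ ^ 2 ≤ rexp (2 * ‖c‖) := by
      have : ‖1 + c‖ ≤ rexp ‖c‖ := by
        have q1 := norm_add_le 1 c
        have q2 := Real.add_one_le_exp ‖c‖
        rw [norm_one] at q1
        linarith
      calc ‖1 + c‖ ^ 2 ≤ rexp ‖c‖ ^ 2 := by gcongr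
        _ = _ := by rw [← Real.exp_nat_mul]; norm_num
    calc ‖1 + c‖ ^ 2 * ‖frL β G a t c‖
        ≤ rexp (2 * ‖c‖) * ((∫ s in Ioi a, ‖G s‖) * Real.exp (K * (t - a) * ‖c‖)) := by gcongr
      _ = (∫ s in Ioi a, ‖G s‖) * (rexp (K * (t - a) * ‖c‖) * rexp (2 * ‖c‖)) := by ring
      _ = _ := by rw [← Real.exp_add]; ring_nf
  · obtain ⟨B, hB⟩ := H.L_real hat hQ
    refine ⟨4 * B, ?_⟩
    rw [eventually_map]
    filter_upwards [eventually_ge_atTop (1 : ℝ)] with x hx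
    have := hB x hx
    rw [norm_mul, norm_pow]
    have h1 : ‖1 + (x : ℂ)‖ = 1 + x := by
      rw [← Complex.ofReal_one, ← Complex.ofReal_add, Complex.norm_real,
        Real.norm_of_nonneg (by linarith)]
    rw [h1]
    have : (1 + x) ^ 2 ≤ 4 * x ^ 2 := by nlinarith
    nlinarith [norm_nonneg (frL β G a t x)]
  · intro y
    have h := H.L_im hat hS y
    rw [norm_mul, norm_pow]
    have h1 : ‖1 + (y : ℂ) * Complex.I‖ ^ 2 = 1 + y ^ 2 := by
      rw [← Complex.normSq_eq_norm_sq, Complex.normSq_apply]; simp; ring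
    rw [h1]
    calc (1 + y ^ 2) * ‖frL β G a t (y * Complex.I)‖
        ≤ (1 + y ^ 2) * (S * (2 * (t - a) / (1 + (t - a) * (y ^ 2 / 2)))) := by gcongr
      _ = S * ((1 + y ^ 2) * (2 * (t - a)) / (1 + (t - a) * (y ^ 2 / 2))) := by ring
      _ ≤ _ := by
        refine mul_le_mul_of_nonneg_left ?_ hS0
        rw [div_le_iff₀ (by positivity)]
        nlinarith [mul_nonneg hT.le (sq_nonneg y), mul_nonneg (mul_nonneg hT.le hT.le) (sq_nonneg y)]

/-- vanishing of the weighted integral along the imaginary axis -/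
lemma FrH.zero_int (H : FrH β G a K) (hat : a < t) (hS : ∀ s ∈ Icc a t, |G s| ≤ S)
    (hQ : EqOn (frL β G a t) (fun c => - frR β G t c) frQ) {x : ℝ} (hx : 0 < x) :
    Integrable (fun y : ℝ => (y : ℂ) * frL β G a t (y * Complex.I) * (x / (x + y * Complex.I))) ∧
    ∫ y : ℝ, (y : ℂ) * frL β G a t (y * Complex.I) * (x / (x + y * Complex.I)) = 0 := by
  obtain ⟨A, hA⟩ := H.L_PL hat hS hQ
  have hxn : ∀ z : ℂ, 0 ≤ z.re → (x : ℂ) + z ≠ 0 := by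
    intro z hz h
    have := congrArg Complex.re h
    simp at this; linarith
  set h : ℂ → ℂ := fun z => z * frL β G a t z * (x / (x + z)) with hh
  have hd : DifferentiableOn ℂ h {z | 0 ≤ z.re} := by
    have h1 := H.L_diff hat
    refine ((differentiable_id.mul h1).differentiableOn).mul ?_
    intro z hz
    refine DifferentiableAt.differentiableWithinAt ?_
    exact (differentiableAt_const _).div (by fun_prop) (hxn z hz)
  have hbd : ∀ z : ℂ, 0 ≤ z.re → ‖h z‖ ≤ (x * A) / ‖1 + z‖ ^ 2 := by
    intro z hz
    have h1 : ‖z‖ ≤ ‖(x : ℂ) + z‖ := by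
      rw [← sq_le_sq₀ (norm_nonneg _) (norm_nonneg _), ← Complex.normSq_eq_norm_sq,
        ← Complex.normSq_eq_norm_sq, Complex.normSq_apply, Complex.normSq_apply]
      simp; nlinarith
    have h2 : 0 < ‖(x : ℂ) + z‖ := norm_pos_iff.2 (hxn z hz)
    have h3 : ‖h z‖ = (‖z‖ / ‖(x : ℂ) + z‖) * (x * ‖frL β G a t z‖) := by
      rw [hh]; simp only [norm_mul, norm_div, Complex.norm_real, Real.norm_of_nonneg hx.le]; ring
    rw [h3, mul_div_assoc]
    refine (mul_le_of_le_one_left (by positivity) ((div_le_one h2).2 h1)).trans ?_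
    exact mul_le_mul_of_nonneg_left (hA z hz) hx.le
  have hcont : Continuous fun y : ℝ => h (y * Complex.I) := by
    refine hd.continuousOn.comp_continuous (by fun_prop) ?_
    intro y; simp
  have hi : Integrable (fun y : ℝ => h (y * Complex.I)) := by
    refine (integrable_inv_one_add_sq.const_mul (x * A)).mono' hcont.aestronglyMeasurable ?_
    refine Eventually.of_forall fun y => ?_
    refine (hbd _ (by simp)).trans (le_of_eq ?_)
    have h1 : ‖1 + (y : ℂ) * Complex.I‖ ^ 2 = 1 + y ^ 2 := by
      rw [← Complex.normSq_eq_norm_sq, Complex.normSq_apply]; simp; ring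
    rw [h1, div_eq_mul_inv]
  have h0 := fr_cauchy h (Or.inr hd) (x * A) hbd hi
  have he : ∀ y : ℝ, (y : ℂ) * frL β G a t (y * Complex.I) * (x / (x + y * Complex.I))
      = -Complex.I * h (y * Complex.I) := by
    intro y
    rw [hh]
    simp only
    linear_combination ((y : ℂ) * frL β G a t (y * Complex.I) * (x / (x + y * Complex.I))) * Complex.I_sq
  simp only [he]
  exact ⟨hi.const_mul _, by rw [integral_const_mul, h0, mul_zero]⟩
end

section
variable {β G : ℝ → ℝ} {a K t S : ℝ}

lemma fr_peak (hat : a < t) (hGc : ContinuousOn G (Icc a t)) :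
    Tendsto (fun l : ℝ => l * ∫ s in Ioc a t, Real.exp (-l * (t - s)) * G s) atTop
      (nhds (G t)) := by
  have hT : 0 < t - a := sub_pos.2 hat
  have key := tendsto_setIntegral_peak_smul_of_integrableOn_of_tendsto (μ := volume)
    (s := Ioc a t) (t := Ioc a t) (x₀ := t) (l := atTop) (g := G) (a := G t)
    (φ := fun l s => l * Real.exp (-l * (t - s))) measurableSet_Ioc measurableSet_Ioc
    Subset.rfl self_mem_nhdsWithin (by simp) ?_ ?_ ?_ ?_ ?_ ?_
  · refine key.congr fun l => ?_
    rw [← integral_const_mul]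
    congr 1
    ext s
    simp [mul_assoc]
  · filter_upwards [eventually_ge_atTop (0 : ℝ)] with l hl s _
    positivity
  · intro u hu htu
    obtain ⟨δ, hδ, hsub⟩ := Metric.isOpen_iff.1 hu t htu
    rw [Metric.tendstoUniformlyOn_iff]
    intro ε hε
    have h1 : Tendsto (fun l : ℝ => l * Real.exp (-(δ * l))) atTop (nhds 0) := by
      have := (Real.tendsto_pow_mul_exp_neg_atTop_nhds_zero 1).comp
        (tendsto_id.const_mul_atTop hδ)
      have h2 := this.const_mul δ⁻¹
      rw [mul_zero] at h2
      refine h2.congr fun l => ?_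
      simp; field_simp
    filter_upwards [h1.eventually (gt_mem_nhds hε), eventually_gt_atTop (0 : ℝ)] with l hl hl0 s hs
    have hd : δ ≤ t - s := by
      by_contra hcon
      apply hs.2
      apply hsub
      rw [Metric.mem_ball, Real.dist_eq, abs_sub_comm, abs_of_nonneg (by linarith [hs.1.2])]
      linarith
    simp only [Pi.zero_apply, dist_zero_left]
    rw [Real.norm_of_nonneg (by positivity)]
    refine lt_of_le_of_lt ?_ hl
    refine mul_le_mul_of_nonneg_left ?_ hl0.le
    rw [Real.exp_le_exp]; nlinarith
  · have h1 : ∀ l : ℝ, ∫ s in Ioc a t, l * Real.exp (-l * (t - s)) = 1 - rexp (-l * (t - a)) := by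
      intro l
      rw [← intervalIntegral.integral_of_le hat.le,
        intervalIntegral.integral_eq_sub_of_hasDerivAt (f := fun s => Real.exp (-l * (t - s)))]
      · simp
      · intro x _
        have : HasDerivAt (fun s => -l * (t - s)) l x := by
          simpa using ((hasDerivAt_id x).const_sub t).const_mul (-l)
        simpa [mul_comm] using this.exp
      · exact (by fun_prop : Continuous fun s => l * Real.exp (-l * (t - s))).intervalIntegrable _ _
    simp only [h1]
    have h2 : Tendsto (fun l : ℝ => rexp (-l * (t - a))) atTop (nhds 0) := by
      refine Real.tendsto_exp_atBot.comp ?_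
      exact tendsto_neg_atTop_atBot.atBot_mul_const hT
    simpa using h2.const_sub 1
  · exact Eventually.of_forall fun l => (by fun_prop : Continuous fun s =>
      l * Real.exp (-l * (t - s))).aestronglyMeasurable
  · exact hGc.integrableOn_Icc.mono_set Ioc_subset_Icc_self
  · exact (hGc t ⟨hat.le, le_rfl⟩).mono Ioc_subset_Icc_self

noncomputable def frM (G : ℝ → ℝ) (a t y : ℝ) : ℝ :=
  ∫ s in Ioc a t, Real.exp (-(y ^ 2 / 2) * (t - s)) * G s

lemma frM_eq (y : ℝ) : frL (fun _ => 0) G a t (y * Complex.I) = (frM G a t y : ℂ) := by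
  rw [frL, frM, ← integral_complex_ofReal]
  congr 1
  ext s
  rw [frE]
  push_cast
  congr 2
  linear_combination ((y : ℂ) ^ 2 * ((t - s) / 2)) * Complex.I_sq

lemma FrH.zero (H : FrH β G a K) : FrH (fun _ => 0) G a 0 where
  hK := le_rfl
  hβc := continuousOn_const
  anti := by simp
  lip := by simp
  hGc := H.hGc
  hGi := H.hGi

lemma FrH.diff_bd (H : FrH β G a K) (hat : a < t) (hS : ∀ s ∈ Icc a t, |G s| ≤ S) (y : ℝ) :
    ‖(y : ℂ) * frL β G a t (y * Complex.I) - (y : ℂ) * frM G a t y‖ ≤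
      8 * (t - a) * (K * S) * (1 + (√(t - a) / 2 * y) ^ 2)⁻¹ := by
  have hT : 0 < t - a := sub_pos.2 hat
  have hK := H.hK
  have hS0 : 0 ≤ S := (abs_nonneg _).trans (hS a ⟨le_rfl, hat.le⟩)
  have i1 := H.integ t (y * Complex.I) _ measurableSet_Ioc Ioc_subset_Ioi_self _
    fun s hs => H.left_bd _ hs
  have i2 := H.zero.integ t (y * Complex.I) _ measurableSet_Ioc Ioc_subset_Ioi_self _
    fun s hs => H.zero.left_bd _ hs
  rw [← frM_eq, ← mul_sub, frL, frL, ← integral_sub i1 i2, ← integral_const_mul]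
  refine (norm_integral_le_of_norm_le
    (g := fun s => 4 * (K * S) * Real.exp (-(y ^ 2 / 4) * (t - s))) ?_ ?_).trans ?_
  · exact (by fun_prop : Continuous fun s =>
      4 * (K * S) * Real.exp (-(y ^ 2 / 4) * (t - s))).integrableOn_Ioc
  · filter_upwards [ae_restrict_mem measurableSet_Ioc] with s hs
    have e1 : frE β t (y * Complex.I) s = frE (fun _ => 0) t (y * Complex.I) s *
        Complex.exp (Complex.I * ((y * (β s - β t) : ℝ) : ℂ)) := by
      rw [frE, frE, ← Complex.exp_add]
      congr 1
      push_cast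
      ring
    have e2 : frE β t (y * Complex.I) s * (G s : ℂ) - frE (fun _ => 0) t (y * Complex.I) s * (G s : ℂ)
        = frE (fun _ => 0) t (y * Complex.I) s *
          (Complex.exp (Complex.I * ((y * (β s - β t) : ℝ) : ℂ)) - 1) * (G s : ℂ) := by
      rw [e1]; ring
    rw [e2, norm_mul, norm_mul, norm_mul, frE_norm, Complex.norm_real, Complex.norm_real]
    have b1 : ‖Complex.exp (Complex.I * ((y * (β s - β t) : ℝ) : ℂ)) - 1‖ ≤ |y| * (K * (t - s)) := by
      refine (Real.norm_exp_I_mul_ofReal_sub_one_le).trans ?_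
      rw [Real.norm_eq_abs, abs_mul]
      refine mul_le_mul_of_nonneg_left ?_ (abs_nonneg _)
      rw [abs_of_nonneg (by linarith [H.anti s t hs.1.le hs.2])]
      exact H.lip s t hs.1.le hs.2
    have b2 := hS s ⟨hs.1.le, hs.2⟩
    have hts : 0 ≤ t - s := by linarith [hs.2]
    have b3 : y ^ 2 * (t - s) * rexp (-(y ^ 2 / 2) * (t - s)) ≤
        4 * rexp (-(y ^ 2 / 4) * (t - s)) := by
      have q1 := Real.add_one_le_exp (y ^ 2 / 4 * (t - s))
      have q2 : rexp (-(y ^ 2 / 4) * (t - s)) =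
          rexp (y ^ 2 / 4 * (t - s)) * rexp (-(y ^ 2 / 2) * (t - s)) := by
        rw [← Real.exp_add]; ring_nf
      rw [q2, ← mul_assoc]
      refine mul_le_mul_of_nonneg_right ?_ (Real.exp_pos _).le
      nlinarith
    have e3 : ((((y : ℂ) * Complex.I).re ^ 2 - ((y : ℂ) * Complex.I).im ^ 2) * ((t - s) / 2) +
        ((y : ℂ) * Complex.I).re * ((fun _ => (0:ℝ)) s - (fun _ => (0:ℝ)) t))
        = -(y ^ 2 / 2) * (t - s) := by
      simp; ring
    rw [e3, Real.norm_eq_abs, Real.norm_eq_abs]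
    calc |y| * (rexp (-(y ^ 2 / 2) * (t - s)) *
          ‖Complex.exp (Complex.I * ((y * (β s - β t) : ℝ) : ℂ)) - 1‖ * |G s|)
        ≤ |y| * (rexp (-(y ^ 2 / 2) * (t - s)) * (|y| * (K * (t - s))) * S) := by gcongr
      _ = K * S * (|y| ^ 2 * (t - s) * rexp (-(y ^ 2 / 2) * (t - s))) := by ring
      _ ≤ K * S * (4 * rexp (-(y ^ 2 / 4) * (t - s))) := by
        rw [sq_abs]; exact mul_le_mul_of_nonneg_left b3 (by positivity)
      _ = _ := by ring
  · rw [integral_const_mul]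
    refine (mul_le_mul_of_nonneg_left (fr_expint a t _ hat (by positivity))
      (by positivity)).trans (le_of_eq ?_)
    rw [mul_pow, div_pow, Real.sq_sqrt hT.le]
    rw [show (t - a) / 2 ^ 2 * y ^ 2 = (t - a) * (y ^ 2 / 4) by ring]
    field_simp
    ring

lemma FrH.main_bd (H : FrH β G a K) (hat : a < t) (hS : ∀ s ∈ Icc a t, |G s| ≤ S)
    (hQ : EqOn (frL β G a t) (fun c => - frR β G t c) frQ) {x : ℝ} (hx : 0 < x) :
    |∫ v : ℝ, (x * v) ^ 2 * frM G a t (x * v) * (1 + v ^ 2)⁻¹| ≤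
      16 * π * K * S * √(t - a) := by
  have hT : 0 < t - a := sub_pos.2 hat
  have hsT : 0 < √(t - a) := Real.sqrt_pos.2 hT
  obtain ⟨hi, hz⟩ := H.zero_int hat hS hQ hx
  set w : ℝ → ℂ := fun y => x / (x + y * Complex.I) with hw
  have hne : ∀ y : ℝ, (x : ℂ) + y * Complex.I ≠ 0 := by
    intro y h
    have := congrArg Complex.re h
    simp at this; linarith
  have hwc : Continuous w := by
    rw [hw]
    exact continuous_const.div (by fun_prop) hne
  have hw1 : ∀ y, ‖w y‖ ≤ 1 := by
    intro y
    rw [hw]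
    simp only [norm_div, Complex.norm_real, Real.norm_of_nonneg hx.le]
    refine div_le_one_of_le₀ ?_ (norm_nonneg _)
    have := Complex.re_le_norm (x + y * Complex.I)
    simpa using this
  have hwim : ∀ y, (w y).im = -(x * y / (x ^ 2 + y ^ 2)) := by
    intro y
    rw [hw]
    simp [Complex.div_im, Complex.normSq_apply]
    ring
  have hLc := (H.L_diff hat).continuous
  have hMc := (H.zero.L_diff hat).continuous
  have hI : Integrable fun y : ℝ => (1 + (√(t - a) / 2 * y) ^ 2)⁻¹ :=
    integrable_inv_one_add_sq.comp_mul_left' (by positivity)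
  have hbd : ∀ y : ℝ, ‖((y : ℂ) * frL β G a t (y * Complex.I) - (y : ℂ) * frM G a t y) * w y‖ ≤
      8 * (t - a) * (K * S) * (1 + (√(t - a) / 2 * y) ^ 2)⁻¹ := by
    intro y
    rw [norm_mul]
    exact (mul_le_of_le_one_right (norm_nonneg _) (hw1 y)).trans (H.diff_bd hat hS y)
  have hDi : Integrable fun y : ℝ =>
      ((y : ℂ) * frL β G a t (y * Complex.I) - (y : ℂ) * frM G a t y) * w y := by
    refine (hI.const_mul _).mono' ?_ (Eventually.of_forall hbd)
    simp only [← frM_eq]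
    exact (by fun_prop : Continuous _).aestronglyMeasurable
  have hD : ‖∫ y : ℝ, ((y : ℂ) * frL β G a t (y * Complex.I) - (y : ℂ) * frM G a t y) * w y‖ ≤
      16 * π * K * S * √(t - a) := by
    refine (norm_integral_le_of_norm_le (hI.const_mul _) (Eventually.of_forall hbd)).trans
      (le_of_eq ?_)
    rw [integral_const_mul, Measure.integral_comp_mul_left (fun y : ℝ => (1 + y ^ 2)⁻¹),
      integral_univ_inv_one_add_sq, abs_of_pos (by positivity), smul_eq_mul]
    field_simp
    rw [Real.sq_sqrt hT.le]
    ring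
  have hMi : Integrable fun y : ℝ => (y : ℂ) * frM G a t y * w y := by
    refine (hi.sub hDi).congr (Eventually.of_forall fun y => ?_)
    simp only [Pi.sub_apply, hw]; ring
  have hMz : ∫ y : ℝ, (y : ℂ) * frM G a t y * w y =
      - ∫ y : ℝ, ((y : ℂ) * frL β G a t (y * Complex.I) - (y : ℂ) * frM G a t y) * w y := by
    rw [← zero_sub, ← hz, ← integral_sub hi hDi]
    congr 1
    ext y
    simp only [hw]; ring
  have him : (∫ y : ℝ, (y : ℂ) * frM G a t y * w y).im =
      ∫ y : ℝ, ((y : ℂ) * frM G a t y * w y).im := by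
    have := integral_im (𝕜 := ℂ) hMi
    simpa using this.symm
  have hscale : ∫ v : ℝ, (x * v) ^ 2 * frM G a t (x * v) * (1 + v ^ 2)⁻¹ =
      - ∫ y : ℝ, ((y : ℂ) * frM G a t y * w y).im := by
    rw [← integral_neg]
    have h1 := Measure.integral_comp_mul_left
      (fun y : ℝ => -((y : ℂ) * frM G a t y * w y).im) x
    rw [abs_of_pos (by positivity), smul_eq_mul] at h1
    have h2 : ∫ y : ℝ, -((y : ℂ) * frM G a t y * w y).im =
        x * ∫ v : ℝ, -(((x * v : ℝ) : ℂ) * frM G a t (x * v) * w (x * v)).im := by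
      rw [h1]; field_simp
    rw [h2, ← integral_const_mul]
    congr 1
    ext v
    rw [← Complex.ofReal_mul, Complex.im_ofReal_mul, hwim]
    have : x ^ 2 + (x * v) ^ 2 = x ^ 2 * (1 + v ^ 2) := by ring
    rw [this]
    have : 0 < 1 + v ^ 2 := by positivity
    field_simp
  rw [hscale, ← him, abs_neg]
  refine (Complex.abs_im_le_norm _).trans ?_
  rw [hMz, norm_neg]
  exact hD

lemma FrH.key (H : FrH β G a K) (hat : a < t) (hS : ∀ s ∈ Icc a t, |G s| ≤ S) (C : ℝ)
    (h0 : ∀ c > C, ∫ s in Ioi a, Real.exp (-c ^ 2 * s / 2 + c * β s) * G s = 0) :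
    |G t| ≤ 8 * K * S * √(t - a) := by
  have hT : 0 < t - a := sub_pos.2 hat
  have hS0 : 0 ≤ S := (abs_nonneg _).trans (hS a ⟨le_rfl, hat.le⟩)
  have hQ := H.L_eq hat C h0
  have hMc := (H.zero.L_diff hat).continuous
  have hlim : Tendsto (fun x : ℝ => ∫ v : ℝ, (x * v) ^ 2 * frM G a t (x * v) * (1 + v ^ 2)⁻¹)
      atTop (nhds (∫ v : ℝ, 2 * G t * (1 + v ^ 2)⁻¹)) := by
    refine tendsto_integral_filter_of_dominated_convergence (fun v => 4 * S * (1 + v ^ 2)⁻¹)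
      ?_ ?_ (integrable_inv_one_add_sq.const_mul _) ?_
    · refine Eventually.of_forall fun x => ?_
      have hc : Continuous (frM G a t) := by
        have h1 : frM G a t = fun y : ℝ => (frL (fun _ => 0) G a t (y * Complex.I)).re := by
          ext y; rw [frM_eq, Complex.ofReal_re]
        rw [h1]
        exact Complex.continuous_re.comp (by fun_prop)
      have h2 : Continuous fun v : ℝ => (1 + v ^ 2)⁻¹ :=
        (by fun_prop : Continuous fun v : ℝ => 1 + v ^ 2).inv₀ fun v => by positivity
      exact (by fun_prop : Continuous fun v : ℝ =>
        (x * v) ^ 2 * frM G a t (x * v) * (1 + v ^ 2)⁻¹).aestronglyMeasurable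
    · refine Eventually.of_forall fun x => Eventually.of_forall fun v => ?_
      have h1 := H.zero.L_im hat hS (x * v)
      rw [frM_eq, Complex.norm_real] at h1
      rw [norm_mul, norm_mul, Real.norm_of_nonneg (by positivity : 0 ≤ (x * v) ^ 2),
        Real.norm_of_nonneg (by positivity : 0 ≤ (1 + v ^ 2)⁻¹)]
      refine mul_le_mul_of_nonneg_right ?_ (by positivity)
      refine (mul_le_mul_of_nonneg_left h1 (by positivity)).trans ?_
      rw [← mul_div_assoc, ← mul_div_assoc, div_le_iff₀ (by positivity)]
      nlinarith [mul_nonneg hS0 (mul_nonneg hT.le (sq_nonneg (x * v)))]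
    · have hv : ∀ᵐ v : ℝ, v ≠ 0 := by
        have : ({0} : Set ℝ)ᶜ ∈ ae (volume : Measure ℝ) := compl_mem_ae_iff.2 (by simp)
        filter_upwards [this] with v hv using hv
      filter_upwards [hv] with v hv
      refine Tendsto.mul_const _ ?_
      have hl : Tendsto (fun x : ℝ => (x * v) ^ 2 / 2) atTop atTop := by
        have h1 : Tendsto (fun x : ℝ => v ^ 2 / 2 * x ^ 2) atTop atTop :=
          (tendsto_pow_atTop two_ne_zero).const_mul_atTop (by positivity)
        exact h1.congr fun x => by ring
      have h2 := ((fr_peak hat (H.hGc.mono fun s hs => hs.1)).comp hl).const_mul 2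
      refine h2.congr fun x => ?_
      simp only [Function.comp, frM]
      ring
  rw [integral_const_mul, integral_univ_inv_one_add_sq] at hlim
  have hle : |2 * G t * π| ≤ 16 * π * K * S * √(t - a) := by
    refine le_of_tendsto hlim.abs ?_
    filter_upwards [eventually_gt_atTop (0 : ℝ)] with x hx
    exact H.main_bd hat hS hQ hx
  rw [abs_mul, abs_mul, abs_of_pos pi_pos, abs_two] at hle
  have := pi_pos
  have h3 : (2 * π) * |G t| ≤ (2 * π) * (8 * K * S * √(t - a)) := by linarith
  exact le_of_mul_le_mul_left h3 (by positivity)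
end

lemma FrH.step {β G : ℝ → ℝ} {a K δ C : ℝ} (H : FrH β G a K) (hδ : 0 < δ)
    (hδK : 8 * K * √δ < 1)
    (h0 : ∀ c > C, ∫ s in Ioi a, Real.exp (-c ^ 2 * s / 2 + c * β s) * G s = 0) :
    ∀ s ∈ Icc a (a + δ), G s = 0 := by
  have hK := H.hK
  obtain ⟨t₀, ht₀, hmax⟩ := (isCompact_Icc (a := a) (b := a + δ)).exists_isMaxOn
    ⟨a, le_rfl, by linarith⟩ ((H.hGc.mono fun s hs => hs.1).abs)
  have hS : ∀ s ∈ Icc a (a + δ), |G s| ≤ |G t₀| := fun s hs => hmax hs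
  have hb : ∀ t ∈ Ioc a (a + δ), |G t| ≤ 8 * K * √δ * |G t₀| := by
    intro t ht
    have h1 := H.key ht.1 (fun s hs => hS s ⟨hs.1, hs.2.trans ht.2⟩) C h0
    refine h1.trans ?_
    have : √(t - a) ≤ √δ := Real.sqrt_le_sqrt (by linarith [ht.2])
    calc 8 * K * |G t₀| * √(t - a) ≤ 8 * K * |G t₀| * √δ := by gcongr
      _ = _ := by ring
  have ha : |G a| ≤ 8 * K * √δ * |G t₀| := by
    have hc : Tendsto (fun s => |G s|) (nhdsWithin a (Ioi a)) (nhds |G a|) :=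
      ((H.hGc a (mem_Ici.2 le_rfl)).mono Ioi_subset_Ici_self).abs
    refine le_of_tendsto hc ?_
    filter_upwards [Ioc_mem_nhdsGT (show a < a + δ by linarith)] with s hs using hb s hs
  have hall : |G t₀| ≤ 8 * K * √δ * |G t₀| := by
    rcases eq_or_lt_of_le ht₀.1 with h | h
    · rw [← h] at ha ⊢; exact ha
    · exact hb t₀ ⟨h, ht₀.2⟩
  have hz : |G t₀| ≤ 0 := by nlinarith [abs_nonneg (G t₀)]
  intro s hs
  exact abs_nonpos_iff.1 ((hS s hs).trans hz)

lemma FrH.uniq {β G : ℝ → ℝ} {K C : ℝ} (H : FrH β G 0 K)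
    (h0 : ∀ c > C, ∫ s in Ioi (0 : ℝ), Real.exp (-c ^ 2 * s / 2 + c * β s) * G s = 0) :
    ∀ s ≥ 0, G s = 0 := by
  have hK := H.hK
  set δ : ℝ := (1 / (16 * (K + 1))) ^ 2 with hδd
  have hδ : 0 < δ := by positivity
  have hδK : 8 * K * √δ < 1 := by
    rw [hδd, Real.sqrt_sq (by positivity), mul_one_div, div_lt_one (by positivity)]
    linarith
  have hn : ∀ n : ℕ, ∀ s ∈ Icc (0 : ℝ) (n * δ), s ∈ Ioi (0 : ℝ) → G s = 0 := by
    intro n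
    induction n with
    | zero =>
      intro s hs hs'
      have h1 : s ≤ 0 := by simpa using hs.2
      exact absurd h1 (not_le.2 hs')
    | succ n ih =>
      intro s hs hs'
      have ha0 : 0 ≤ (n : ℝ) * δ := by positivity
      rcases le_total s (n * δ) with h | h
      · exact ih s ⟨hs.1, h⟩ hs'
      · have H' : FrH β G (n * δ) K :=
          { hK := hK
            hβc := H.hβc.mono (Ici_subset_Ici.2 ha0)
            anti := fun s s' h => H.anti s s' (ha0.trans h)
            lip := fun s s' h => H.lip s s' (ha0.trans h)
            hGc := H.hGc.mono (Ici_subset_Ici.2 ha0)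
            hGi := H.hGi.mono_set (Ioi_subset_Ioi ha0) }
        refine H'.step (C := C) hδ hδK (fun c hc => ?_) s ⟨h, ?_⟩
        · rw [← h0 c hc]
          symm
          refine setIntegral_eq_of_subset_of_forall_sdiff_eq_zero measurableSet_Ioi
            (Ioi_subset_Ioi ha0) ?_
          intro x hx
          rw [ih x ⟨le_of_lt hx.1, not_lt.1 hx.2⟩ hx.1, mul_zero]
        · have := hs.2
          push_cast at this
          linarith
  have hpos : ∀ s ≥ 0, s ∈ Ioi (0 : ℝ) → G s = 0 := by
    intro s hs hs'
    obtain ⟨n, hn'⟩ := exists_nat_ge (s / δ)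
    exact hn n s ⟨hs, (div_le_iff₀ hδ).1 hn'⟩ hs'
  intro s hs
  exact H.step hδ hδK h0 0 ⟨le_rfl, by linarith⟩ |> fun h => by
    rcases eq_or_lt_of_le hs with hzero | hspos
    · rw [← hzero]; exact h
    · exact hpos s hs hspos

/-- Uniqueness for the Fredholm equation. -/
lemma fr_unique (b f ftil : ℝ → ℝ) (C : ℝ) (K : NNReal)
    (hblip : LipschitzOnWith K b (Ici 0))
    (hfc : ContinuousOn f (Ici 0)) (hfint : IntegrableOn f (Ici 0))
    (hftc : ContinuousOn ftil (Ici 0)) (hftint : IntegrableOn ftil (Ici 0))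
    (hC : 0 < C)
    (heq : ∀ c > C,
      (∫ s in Ioi (0 : ℝ), Real.exp (-c ^ 2 * s / 2 + c * b s) * f s) =
      ∫ s in Ioi (0 : ℝ), Real.exp (-c ^ 2 * s / 2 + c * b s) * ftil s) :
    ∀ s ≥ 0, f s = ftil s := by
  have hbc : ContinuousOn b (Ici 0) := hblip.continuousOn
  have hlip : ∀ s s' : ℝ, 0 ≤ s → s ≤ s' → |b s - b s'| ≤ K * (s' - s) := by
    intro s s' hs hss
    have := hblip.dist_le_mul s hs s' (hs.trans hss)
    rwa [Real.dist_eq, Real.dist_eq, abs_sub_comm s s', abs_of_nonneg (sub_nonneg.2 hss)] at this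
  set κ : ℝ := (K : ℝ) with hκ
  have hκ0 : 0 ≤ κ := K.coe_nonneg
  have hint : ∀ c : ℝ, 2 * κ ≤ c → ∀ g : ℝ → ℝ, IntegrableOn g (Ici 0) →
      IntegrableOn (fun s => Real.exp (-c ^ 2 * s / 2 + c * b s) * g s) (Ioi 0) := by
    intro c hc g hg
    have hg' := hg.mono_set (Ioi_subset_Ici_self (a := (0:ℝ)))
    refine (hg'.norm.const_mul (Real.exp (c * b 0))).mono' ?_ ?_
    · refine AEStronglyMeasurable.mul ?_ hg'.1
      have : ContinuousOn (fun s => Real.exp (-c ^ 2 * s / 2 + c * b s)) (Ioi 0) := by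
        have := hbc.mono (Ioi_subset_Ici_self (a := (0:ℝ)))
        fun_prop
      exact this.aestronglyMeasurable measurableSet_Ioi
    · filter_upwards [ae_restrict_mem measurableSet_Ioi] with s hs
      have hs' : 0 < s := hs
      rw [norm_mul, Real.norm_of_nonneg (Real.exp_pos _).le]
      refine mul_le_mul_of_nonneg_right ?_ (norm_nonneg _)
      rw [Real.exp_le_exp]
      have h1 := (abs_le.1 (hlip 0 s le_rfl hs'.le)).1
      have hc0 : 0 ≤ c := by linarith
      have h2 : c * b s ≤ c * (b 0 + κ * s) := mul_le_mul_of_nonneg_left (by linarith) hc0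
      nlinarith [mul_nonneg (mul_nonneg hc0 hs'.le) (sub_nonneg.2 hc)]
  set μ : ℝ := 2 * κ with hμ
  have H : FrH (fun s => b s - μ * s)
      (fun s => Real.exp (-μ ^ 2 * s / 2 + μ * b s) * (f s - ftil s)) 0 (κ + μ) :=
    { hK := by positivity
      hβc := by fun_prop
      anti := fun s s' hs hss => by
        have := (abs_le.1 (hlip s s' hs hss)).1
        nlinarith
      lip := fun s s' hs hss => by
        have := (abs_le.1 (hlip s s' hs hss)).2
        linarith
      hGc := by fun_prop
      hGi := hint μ le_rfl _ (hfint.sub hftint) }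
  have hG := H.uniq (C := C) ?_
  · intro s hs
    have := hG s hs
    have h2 := (mul_eq_zero.1 this).resolve_left (Real.exp_pos _).ne'
    linarith
  · intro c hc
    have hc' : μ ≤ c + μ := by linarith
    have h1 := heq (c + μ) (by linarith [show 0 ≤ μ by positivity])
    rw [← sub_eq_zero, ← integral_sub (hint _ hc' _ hfint) (hint _ hc' _ hftint)] at h1
    refine Eq.trans ?_ h1
    congr 1
    ext s
    rw [← mul_assoc, ← Real.exp_add, ← mul_sub]
    congr 2
    ring

/-- If the Fredholm transforms of `f` and `f̃` agree for all `c > C`, then so do all the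
moment-weighted transforms `I^f(n)(c)` and `I^{f̃}(n)(c)` for all `n ∈ ℕ` and `c > C`
for which the integrals exist. -/
theorem moments_eq_of_fredholm_eq (b f ftil : ℝ → ℝ) (M m C : ℝ) (K : NNReal)
    (hb : ContDiffOn ℝ 1 b (Ici 0)) (hblip : LipschitzOnWith K b (Ici 0))
    (hM : 0 < M) (hm : 0 < m) (hgrowth : ∀ s ≥ (0 : ℝ), b s ≤ M + m * s)
    (hfc : ContinuousOn f (Ici 0)) (hfint : IntegrableOn f (Ici 0))
    (hfpos : ∀ s > (0 : ℝ), 0 < f s)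
    (hftc : ContinuousOn ftil (Ici 0)) (hftint : IntegrableOn ftil (Ici 0))
    (hftpos : ∀ s > (0 : ℝ), 0 < ftil s)
    (hC : 0 < C)
    (heq : ∀ c > C,
      (∫ s in Ioi (0 : ℝ), Real.exp (-c ^ 2 * s / 2 + c * b s) * f s) =
      ∫ s in Ioi (0 : ℝ), Real.exp (-c ^ 2 * s / 2 + c * b s) * ftil s) :
    ∀ (n : ℕ), ∀ c > C,
      IntegrableOn (fun s => Real.exp (-c ^ 2 * s / 2 + c * b s) * s ^ n * f s) (Ioi 0) →
      IntegrableOn (fun s => Real.exp (-c ^ 2 * s / 2 + c * b s) * s ^ n * ftil s) (Ioi 0) →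
      (∫ s in Ioi (0 : ℝ), Real.exp (-c ^ 2 * s / 2 + c * b s) * s ^ n * f s) =
      ∫ s in Ioi (0 : ℝ), Real.exp (-c ^ 2 * s / 2 + c * b s) * s ^ n * ftil s := by
  intro n c _ _ _
  have h := fr_unique b f ftil C K hblip hfc hfint hftc hftint hC heq
  refine setIntegral_congr_fun measurableSet_Ioi fun s hs => ?_
  simp only [h s (le_of_lt hs)]
end
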